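/- arXiv:2307.01839 — 2 statements merged into one kernel-verified Lean document; each statement's English description precedes it below -/
import Mathlib

section
/- For d ≥ 2 and κ_i > −1 (i = 1,…,d+1), and for all twice continuously differentiable functions f and g on △^d, one has − ∫_{△^d} D_κ f(x) · g(x) W_κ(x) dx = Σ_{i=1}^d ∫_{△^d} x_i (1−|x|) ∂_i f(x) ∂_i g(x) W_κ(x) dx + Σ_{1≤i<j≤d} ∫_{△^d} x_i x_j ∂_{i,j} f(x) ∂_{i,j} g(x) W_κ(x) dx. -/
open MeasureTheory Finset

noncomputable section

/-- The simplex `△^d = {x : x_i ≥ 0, x_1 + ⋯ + x_d ≤ 1}`. -/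
def Splx (d : ℕ) : Set (Fin d → ℝ) := {x | (∀ i, 0 ≤ x i) ∧ ∑ i, x i ≤ 1}

/-- The `i`-th partial derivative. -/
def pd {d : ℕ} (i : Fin d) (f : (Fin d → ℝ) → ℝ) : (Fin d → ℝ) → ℝ :=
  fun x => fderiv ℝ f x (Pi.single i 1)

/-- `∂_{i,j} = ∂_i - ∂_j`. -/
def pdd {d : ℕ} (i j : Fin d) (f : (Fin d → ℝ) → ℝ) : (Fin d → ℝ) → ℝ :=
  fun x => pd i f x - pd j f x

/-- `⟨x,∇⟩ = ∑ x_i ∂_i`. -/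
def xgrad {d : ℕ} (f : (Fin d → ℝ) → ℝ) : (Fin d → ℝ) → ℝ :=
  fun x => ∑ i, x i * pd i f x

/-- The Jacobi weight `W_κ(x) = x_1^{κ_1} ⋯ x_d^{κ_d} (1-|x|)^{κ_{d+1}}`. -/
def Wk {d : ℕ} (κ : Fin (d+1) → ℝ) (x : Fin d → ℝ) : ℝ :=
  (∏ i : Fin d, x i ^ κ i.castSucc) * (1 - ∑ i, x i) ^ κ (Fin.last d)

/-- The spectral operator `D_κ`. -/
def Dk {d : ℕ} (κ : Fin (d+1) → ℝ) (f : (Fin d → ℝ) → ℝ) (x : Fin d → ℝ) : ℝ :=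
  (∑ i, x i * (1 - x i) * pd i (pd i f) x)
    - 2 * ∑ i, ∑ j ∈ Finset.univ.filter (fun j => i < j), x i * x j * pd i (pd j f) x
    + ∑ i, (κ i.castSucc + 1 - ((∑ k, κ k) + (d : ℝ) + 1) * x i) * pd i f x

/-- The normalizing constant `b_κ`. -/
def bk {d : ℕ} (κ : Fin (d+1) → ℝ) : ℝ :=
  Real.Gamma ((∑ i, κ i) + (d : ℝ) + 1) / ∏ i, Real.Gamma (κ i + 1)

/-- The inner product `⟨f,g⟩_κ = b_κ ∫_{△^d} f g W_κ`. -/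
def ipk {d : ℕ} (κ : Fin (d+1) → ℝ) (f g : (Fin d → ℝ) → ℝ) : ℝ :=
  bk κ * ∫ x in Splx d, f x * g x * Wk κ x

/-- The norm `‖f‖_{κ,2}`. -/
def nrm2 {d : ℕ} (κ : Fin (d+1) → ℝ) (f : (Fin d → ℝ) → ℝ) : ℝ :=
  Real.sqrt (ipk κ f f)

/-- Membership in `V_n^d(W_κ)`: a polynomial of degree (at most) `n` orthogonal to all
polynomials of lower degree. -/
def InVn (d n : ℕ) (κ : Fin (d+1) → ℝ) (f : MvPolynomial (Fin d) ℝ) : Prop :=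
  f.totalDegree ≤ n ∧ ∀ g : MvPolynomial (Fin d) ℝ, g.totalDegree < n →
    ipk κ (fun x => MvPolynomial.eval x f) (fun x => MvPolynomial.eval x g) = 0

/-- `x_k` for `1 ≤ k ≤ d+1`, with the convention `x_{d+1} = 1 - |x|`. -/
def xe {d : ℕ} (x : Fin d → ℝ) (k : Fin (d+1)) : ℝ :=
  if h : (k : ℕ) < d then x ⟨(k : ℕ), h⟩ else 1 - ∑ i, x i

section
open Filter Topology

@[simp] lemma xe_castSucc {d : ℕ} (x : Fin d → ℝ) (i : Fin d) : xe x i.castSucc = x i := by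
  simp [xe]

@[simp] lemma xe_last {d : ℕ} (x : Fin d → ℝ) : xe x (Fin.last d) = 1 - ∑ i, x i := by
  simp [xe]

lemma sum_xe {d : ℕ} (x : Fin d → ℝ) : ∑ m, xe x m = 1 := by
  simp [Fin.sum_univ_castSucc]

lemma Wk_eq_prod_xe {d : ℕ} (κ : Fin (d+1) → ℝ) (x : Fin d → ℝ) :
    Wk κ x = ∏ m, xe x m ^ κ m := by
  simp [Wk, Fin.prod_univ_castSucc]

lemma continuous_xe {d : ℕ} (m : Fin (d+1)) : Continuous fun x : Fin d → ℝ => xe x m := by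
  induction m using Fin.lastCases <;> simp <;> fun_prop

/-- The linear part of the affine function `xe · m`. -/
def xeLin {d : ℕ} (m : Fin (d+1)) : (Fin d → ℝ) →ₗ[ℝ] ℝ where
  toFun x := xe x m - xe 0 m
  map_add' x y := by
    induction m using Fin.lastCases
    · simp [Finset.sum_add_distrib]; ring
    · simp
  map_smul' c x := by
    induction m using Fin.lastCases <;> simp [Finset.mul_sum]

lemma xe_eq_xeLin_add {d : ℕ} (m : Fin (d+1)) (x : Fin d → ℝ) :
    xe x m = xeLin m x + xe 0 m := by
  simp [xeLin]

lemma xe_add_smul {d : ℕ} (m : Fin (d+1)) (x v : Fin d → ℝ) (t : ℝ) :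
    xe (x + t • v) m = xe x m + t * xeLin m v := by
  rw [xe_eq_xeLin_add m (x + t • v), xe_eq_xeLin_add m x, map_add, map_smul, smul_eq_mul]; ring

lemma sum_xeLin {d : ℕ} (x : Fin d → ℝ) : ∑ m, xeLin m x = 0 := by
  simp [xeLin, sum_xe]

/-- The open simplex, the set where all barycentric coordinates are positive. -/
def openSplx (d : ℕ) : Set (Fin d → ℝ) := {x | ∀ m, 0 < xe x m}

lemma mem_Splx_iff {d : ℕ} (x : Fin d → ℝ) : x ∈ Splx d ↔ ∀ m, 0 ≤ xe x m := by
  rw [Fin.forall_fin_succ']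
  simp [Splx, sub_nonneg]

lemma openSplx_subset (d : ℕ) : openSplx d ⊆ Splx d := fun x hx =>
  (mem_Splx_iff x).2 fun m => (hx m).le

lemma isOpen_openSplx (d : ℕ) : IsOpen (openSplx d) := by
  have : openSplx d = ⋂ m, {x | 0 < xe x m} := by ext x; simp [openSplx]
  rw [this]
  exact isOpen_iInter_of_finite fun m => isOpen_lt continuous_const (continuous_xe m)

lemma xe_le_one {d : ℕ} {x : Fin d → ℝ} (hx : x ∈ Splx d) (m : Fin (d+1)) : xe x m ≤ 1 := by
  rw [← sum_xe x]
  exact Finset.single_le_sum (f := fun m => xe x m) (fun i _ => (mem_Splx_iff x).1 hx i)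
    (Finset.mem_univ m)

lemma isCompact_Splx (d : ℕ) : IsCompact (Splx d) := by
  refine Metric.isCompact_of_isClosed_isBounded ?_ ?_
  · have : Splx d = ⋂ m, {x | 0 ≤ xe x m} := by ext x; simp [mem_Splx_iff]
    rw [this]
    exact isClosed_iInter fun m => isClosed_le continuous_const (continuous_xe m)
  · refine (Metric.isBounded_Icc (0 : Fin d → ℝ) 1).subset fun x hx => ⟨hx.1, fun i => ?_⟩
    simpa using xe_le_one hx i.castSucc

lemma convex_Splx (d : ℕ) : Convex ℝ (Splx d) := by
  intro x hx y hy a b ha hb hab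
  rw [mem_Splx_iff] at *
  intro m
  have : xe (a • x + b • y) m = a * xe x m + b * xe y m := by
    rw [xe_eq_xeLin_add m (a • x + b • y), xe_eq_xeLin_add m x, xe_eq_xeLin_add m y, map_add,
      map_smul, map_smul, smul_eq_mul, smul_eq_mul]
    linear_combination -hab * xe (0 : Fin d → ℝ) m
  rw [this]
  exact add_nonneg (mul_nonneg ha (hx m)) (mul_nonneg hb (hy m))

lemma openSplx_nonempty (d : ℕ) : (openSplx d).Nonempty := by
  refine ⟨fun _ => 1 / (d + 1), fun m => ?_⟩
  have hd : (0 : ℝ) < d + 1 := by positivity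
  induction m using Fin.lastCases
  · simp only [xe_last, Finset.sum_const, Finset.card_univ, Fintype.card_fin, nsmul_eq_mul]
    have : 1 - (d : ℝ) * (1 / (d + 1)) = 1 / (d + 1) := by field_simp; ring
    rw [this]; positivity
  · simp only [xe_castSucc]; positivity

lemma openSplx_subset_interior (d : ℕ) : openSplx d ⊆ interior (Splx d) :=
  interior_maximal (openSplx_subset d) (isOpen_openSplx d)

lemma uniqueDiffOn_Splx (d : ℕ) : UniqueDiffOn ℝ (Splx d) :=
  uniqueDiffOn_convex (convex_Splx d) ((openSplx_nonempty d).mono (openSplx_subset_interior d))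

lemma exists_xeLin_neg {d : ℕ} (hd : 0 < d) (m : Fin (d+1)) : ∃ v, xeLin m v < 0 := by
  have : NeZero d := ⟨hd.ne'⟩
  induction m using Fin.lastCases with
  | last => exact ⟨Pi.single 0 1, by simp [xeLin]⟩
  | cast i => exact ⟨Pi.single i (-1), by simp [xeLin]⟩

lemma interior_Splx {d : ℕ} (hd : 0 < d) : interior (Splx d) = openSplx d := by
  refine Set.Subset.antisymm (fun x hx m => ?_) (openSplx_subset_interior d)
  obtain ⟨v, hv⟩ := exists_xeLin_neg hd m
  have hc : ContinuousAt (fun t : ℝ => x + t • v) 0 := by fun_prop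
  have h1 : ∀ᶠ t in 𝓝[>] (0 : ℝ), x + t • v ∈ Splx d := by
    refine (hc.eventually_mem ?_).filter_mono nhdsWithin_le_nhds
    simpa using mem_interior_iff_mem_nhds.1 hx
  obtain ⟨t, ht, ht0⟩ := (h1.and self_mem_nhdsWithin).exists
  have := (mem_Splx_iff _).1 ht m
  rw [xe_add_smul] at this
  nlinarith [mul_neg_of_pos_of_neg ht0 hv]

lemma openSplx_ae_eq_Splx {d : ℕ} (hd : 0 < d) :
    (openSplx d : Set (Fin d → ℝ)) =ᵐ[volume] Splx d := by
  rw [← interior_Splx hd]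
  exact interior_ae_eq_of_null_frontier ((convex_Splx d).addHaar_frontier volume)

lemma integrable_indicator_rpow {r : ℝ} (hr : -1 < r) :
    Integrable ((Set.Ioc (0 : ℝ) 1).indicator fun t => t ^ r) := by
  rw [integrable_indicator_iff measurableSet_Ioc]
  exact (intervalIntegrable_iff_integrableOn_Ioc_of_le zero_le_one).1
    (intervalIntegral.intervalIntegrable_rpow' hr)

/-- The barycentric coordinates other than the `m`-th one, up to translation. -/
def xeLinOmit {d : ℕ} (m : Fin (d+1)) : (Fin d → ℝ) →ₗ[ℝ] (Fin d → ℝ) :=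
  LinearMap.pi fun j => xeLin (m.succAbove j)

lemma xeLinOmit_injective {d : ℕ} (m : Fin (d+1)) : Function.Injective (xeLinOmit m) := by
  rw [← LinearMap.ker_eq_bot, LinearMap.ker_eq_bot']
  intro x hx
  have h1 : ∀ j, xeLin (m.succAbove j) x = 0 := fun j => by
    simpa [xeLinOmit] using congrFun hx j
  have h2 : xeLin m x = 0 := by
    have := sum_xeLin x
    rw [Fin.sum_univ_succAbove _ m] at this
    simpa [h1] using this
  have h3 : ∀ i, xeLin i x = 0 := fun i => by
    rcases Fin.eq_self_or_eq_succAbove m i with h | ⟨j, rfl⟩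
    · rw [h, h2]
    · exact h1 j
  ext i
  simpa [xeLin] using h3 i.castSucc

lemma integrable_prod_succAbove {d : ℕ} (m : Fin (d+1)) {h : Fin (d+1) → ℝ → ℝ}
    (hh : ∀ i, Integrable (h i)) :
    Integrable fun x : Fin d → ℝ => ∏ j, h (m.succAbove j) (xe x (m.succAbove j)) := by
  have h1 : Integrable fun y : Fin d → ℝ => ∏ j, h (m.succAbove j) (y j) :=
    Integrable.fintype_prod fun j => hh (m.succAbove j)
  have h2 := h1.comp_add_right fun j => xe (0 : Fin d → ℝ) (m.succAbove j)
  have hdet : LinearMap.det (xeLinOmit m) ≠ 0 := by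
    have := (LinearEquiv.ofInjectiveEndo _ (xeLinOmit_injective m)).isUnit_det'
    exact this.ne_zero
  have h3 : Integrable (fun y : Fin d → ℝ => ∏ j, h (m.succAbove j)
      ((y + fun j => xe (0 : Fin d → ℝ) (m.succAbove j)) j))
      (Measure.map (xeLinOmit m) volume) := by
    rw [Measure.map_linearMap_addHaar_eq_smul_addHaar _ hdet]
    exact h2.smul_measure ENNReal.ofReal_ne_top
  have h4 := h3.comp_measurable (xeLinOmit m).continuous_of_finiteDimensional.measurable
  convert h4 using 2 with x
  simp [xeLinOmit, ← xe_eq_xeLin_add]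

lemma Wk_nonneg {d : ℕ} (κ : Fin (d+1) → ℝ) {x : Fin d → ℝ} (hx : x ∈ Splx d) : 0 ≤ Wk κ x := by
  rw [Wk_eq_prod_xe]
  exact Finset.prod_nonneg fun m _ => Real.rpow_nonneg ((mem_Splx_iff x).1 hx m) _

lemma continuousOn_Wk {d : ℕ} (κ : Fin (d+1) → ℝ) : ContinuousOn (Wk κ) (openSplx d) := by
  simp only [funext (Wk_eq_prod_xe κ)]
  exact continuousOn_finsetProd _ fun m _ =>
    (continuous_xe m).continuousOn.rpow_const fun x hx => Or.inl (hx m).ne'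

lemma exists_le_xe {d : ℕ} (x : Fin d → ℝ) : ∃ m, 1 / ((d : ℝ) + 1) ≤ xe x m := by
  by_contra! h
  have h1 : ∑ m, xe x m < ∑ _m : Fin (d+1), 1 / ((d : ℝ) + 1) :=
    Finset.sum_lt_sum_of_nonempty Finset.univ_nonempty fun m _ => h m
  rw [sum_xe] at h1
  have : (d : ℝ) + 1 ≠ 0 := by positivity
  simp [this] at h1

lemma rpow_le_one_add_rpow {c t r : ℝ} (hc : 0 < c) (ht : c ≤ t) (ht1 : t ≤ 1) :
    t ^ r ≤ 1 + c ^ r := by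
  rcases le_total 0 r with hr | hr
  · exact (Real.rpow_le_one (hc.le.trans ht) ht1 hr).trans
      (le_add_of_nonneg_right (Real.rpow_nonneg hc.le _))
  · exact (Real.rpow_le_rpow_of_nonpos hc ht hr).trans (le_add_of_nonneg_left zero_le_one)

lemma integrableOn_Wk {d : ℕ} {κ : Fin (d+1) → ℝ} (hκ : ∀ i, -1 < κ i) :
    IntegrableOn (Wk κ) (openSplx d) := by
  set h : Fin (d+1) → ℝ → ℝ := fun i => (Set.Ioc (0 : ℝ) 1).indicator fun t => t ^ κ i with hdef
  have h0 : ∀ i t, 0 ≤ h i t := fun i t =>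
    Set.indicator_nonneg (fun t ht => Real.rpow_nonneg ht.1.le _) t
  have hI : Integrable fun x : Fin d → ℝ => ∑ m, (1 + (1 / ((d : ℝ) + 1)) ^ κ m) *
      ∏ j, h (m.succAbove j) (xe x (m.succAbove j)) :=
    integrable_finsetSum _ fun m _ =>
      (integrable_prod_succAbove m fun i => integrable_indicator_rpow (hκ i)).const_mul _
  refine hI.integrableOn.mono'
    ((continuousOn_Wk κ).aestronglyMeasurable (isOpen_openSplx d).measurableSet) ?_
  refine (ae_restrict_iff' (isOpen_openSplx d).measurableSet).2 (ae_of_all _ fun x hx => ?_)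
  have hxS := openSplx_subset d hx
  rw [Real.norm_of_nonneg (Wk_nonneg κ hxS)]
  obtain ⟨m, hm⟩ := exists_le_xe x
  have hd : (0 : ℝ) < 1 / ((d : ℝ) + 1) := by positivity
  have hnn : ∀ m : Fin (d+1), 0 ≤ (1 + (1 / ((d : ℝ) + 1)) ^ κ m) *
      ∏ j, h (m.succAbove j) (xe x (m.succAbove j)) := fun m =>
    mul_nonneg (by positivity) (Finset.prod_nonneg fun j _ => h0 _ _)
  refine le_trans ?_ (Finset.single_le_sum (fun m _ => hnn m) (Finset.mem_univ m))
  rw [Wk_eq_prod_xe, Fin.prod_univ_succAbove _ m]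
  have : ∀ i, h i (xe x i) = xe x i ^ κ i := fun i =>
    Set.indicator_of_mem (Set.mem_Ioc.2 ⟨hx i, xe_le_one hxS i⟩) _
  simp only [this]
  exact mul_le_mul_of_nonneg_right (rpow_le_one_add_rpow hd hm (xe_le_one hxS m))
    (Finset.prod_nonneg fun j _ => Real.rpow_nonneg (hx _).le _)

lemma integrableOn_mul_Wk {d : ℕ} {κ : Fin (d+1) → ℝ} (hκ : ∀ i, -1 < κ i)
    {c : (Fin d → ℝ) → ℝ} (hc : ContinuousOn c (Splx d)) :
    IntegrableOn (fun x => c x * Wk κ x) (openSplx d) := by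
  obtain ⟨C, hC⟩ := (isCompact_Splx d).exists_bound_of_continuousOn hc
  refine Integrable.bdd_mul (c := C) (integrableOn_Wk hκ)
    ((hc.mono (openSplx_subset d)).aestronglyMeasurable (isOpen_openSplx d).measurableSet) ?_
  exact (ae_restrict_iff' (isOpen_openSplx d).measurableSet).2
    (ae_of_all _ fun x hx => hC x (openSplx_subset d hx))

lemma exists_smooth_cutoff : ∃ (χ χ' : ℝ → ℝ) (C : ℝ), Continuous χ ∧ Continuous χ' ∧
    (∀ t, HasDerivAt χ (χ' t) t) ∧ (∀ t, |χ t| ≤ 1) ∧ (∀ t, |t * χ' t| ≤ C) ∧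
    (∀ t ≤ 1, χ t = 0) ∧ (∀ t, 2 < t → χ t = 1) ∧ (∀ t, 2 < t → χ' t = 0) := by
  have hχ : ContDiff ℝ 1 fun t : ℝ => Real.smoothTransition (t - 1) :=
    Real.smoothTransition.contDiff.comp (contDiff_id.sub contDiff_const)
  have hc := hχ.continuous_deriv_one
  have h0 : ∀ t ≤ 1, Real.smoothTransition (t - 1) = 0 := fun t ht =>
    Real.smoothTransition.zero_of_nonpos (by linarith)
  have h1 : ∀ t, 2 < t → Real.smoothTransition (t - 1) = 1 := fun t ht =>
    Real.smoothTransition.one_of_one_le (by linarith)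
  have hd1 : ∀ t : ℝ, 2 < t → deriv (fun t : ℝ => Real.smoothTransition (t - 1)) t = 0 :=
    fun t ht => by
      have : (fun t : ℝ => Real.smoothTransition (t - 1)) =ᶠ[𝓝 t] fun _ => 1 :=
        (eventually_gt_nhds ht).mono h1
      rw [this.deriv_eq, deriv_const]
  have hd0 : ∀ t : ℝ, t < 1 → deriv (fun t : ℝ => Real.smoothTransition (t - 1)) t = 0 :=
    fun t ht => by
      have : (fun t : ℝ => Real.smoothTransition (t - 1)) =ᶠ[𝓝 t] fun _ => 0 :=
        (eventually_lt_nhds ht).mono fun s hs => h0 s hs.le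
      rw [this.deriv_eq, deriv_const]
  obtain ⟨C, hC⟩ := (isCompact_Icc (a := (1 : ℝ)) (b := 2)).exists_bound_of_continuousOn
    (continuous_id.mul hc).continuousOn
  refine ⟨_, _, max C 0, hχ.continuous, hc,
    fun t => (hχ.differentiable one_ne_zero t).hasDerivAt, fun t => ?_, fun t => ?_, h0, h1, hd1⟩
  · rw [abs_of_nonneg (Real.smoothTransition.nonneg _)]
    exact Real.smoothTransition.le_one _
  · rcases lt_or_ge t 1 with h | h
    · simp [hd0 t h]
    · rcases lt_or_ge 2 t with h' | h'
      · simp [hd1 t h']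
      · exact (hC t ⟨h, h'⟩).trans (le_max_left _ _)

lemma hasLineDerivAt_Wk {d : ℕ} (κ : Fin (d+1) → ℝ) {x : Fin d → ℝ} (hx : x ∈ openSplx d)
    (v : Fin d → ℝ) :
    HasLineDerivAt ℝ (Wk κ) (Wk κ x * ∑ m, xeLin m v * (κ m / xe x m)) x v := by
  simp only [HasLineDerivAt, Wk_eq_prod_xe, xe_add_smul]
  have h : ∀ m, HasDerivAt (fun t : ℝ => (xe x m + t * xeLin m v) ^ κ m)
      (xeLin m v * κ m * xe x m ^ (κ m - 1)) 0 := fun m => by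
    have h1 : HasDerivAt (fun t : ℝ => xe x m + t * xeLin m v) (xeLin m v) 0 := by
      simpa using ((hasDerivAt_id (0 : ℝ)).mul_const (xeLin m v)).const_add (xe x m)
    simpa using h1.rpow_const (p := κ m) (Or.inl (by simpa using (hx m).ne'))
  refine (HasDerivAt.fun_finsetProd (u := Finset.univ) fun m _ => h m).congr_deriv ?_
  rw [Finset.mul_sum]
  refine Finset.sum_congr rfl fun m _ => ?_
  rw [← Finset.mul_prod_erase _ _ (Finset.mem_univ m), Real.rpow_sub_one (hx m).ne']
  simp only [zero_mul, add_zero, smul_eq_mul]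
  ring

lemma hasLineDerivAt_xe {d : ℕ} (m : Fin (d+1)) (x v : Fin d → ℝ) :
    HasLineDerivAt ℝ (fun x => xe x m) (xeLin m v) x v := by
  simp only [HasLineDerivAt, xe_add_smul]
  simpa using ((hasDerivAt_id (0 : ℝ)).mul_const (xeLin m v)).const_add (xe x m)

/-- The direction `v` increases the `k`-th barycentric coordinate, decreases the `l`-th one, and
fixes all others. -/
def IsEdgeDir {d : ℕ} (k l : Fin (d+1)) (v : Fin d → ℝ) : Prop :=
  k ≠ l ∧ ∀ m, xeLin m v = (if m = k then 1 else 0) - (if m = l then 1 else 0)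

lemma IsEdgeDir.hasLineDerivAt_Wk {d : ℕ} {k l : Fin (d+1)} {v : Fin d → ℝ}
    (hv : IsEdgeDir k l v) (κ : Fin (d+1) → ℝ) {x : Fin d → ℝ} (hx : x ∈ openSplx d) :
    HasLineDerivAt ℝ (Wk κ) (Wk κ x * (κ k / xe x k - κ l / xe x l)) x v := by
  have h := _root_.hasLineDerivAt_Wk κ hx v
  simpa [hv.2, sub_mul, Finset.sum_sub_distrib] using h

lemma IsEdgeDir.hasLineDerivAt_mul_Wk {d : ℕ} {k l : Fin (d+1)} {v : Fin d → ℝ}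
    (hv : IsEdgeDir k l v) (κ : Fin (d+1) → ℝ) {x : Fin d → ℝ} (hx : x ∈ openSplx d) :
    HasLineDerivAt ℝ (fun x => xe x k * xe x l * Wk κ x)
      (((κ k + 1) * xe x l - (κ l + 1) * xe x k) * Wk κ x) x v := by
  have hk : xeLin k v = 1 := by simp [hv.2, hv.1]
  have hl : xeLin l v = -1 := by simp [hv.2, hv.1.symm]
  have h := ((hasLineDerivAt_xe k x v).fun_mul (hasLineDerivAt_xe l x v)).fun_mul
    (hv.hasLineDerivAt_Wk κ hx)
  have hxk := (hx k).ne'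
  have hxl := (hx l).ne'
  simp only [HasLineDerivAt] at h ⊢
  refine h.congr_deriv ?_
  simp only [hk, hl, zero_smul, add_zero]
  field_simp
  ring

lemma Wk_one_pos {d : ℕ} {x : Fin d → ℝ} (hx : x ∈ openSplx d) :
    0 < Wk (fun _ : Fin (d+1) => 1) x := by
  rw [Wk_eq_prod_xe]
  exact Finset.prod_pos fun m _ => Real.rpow_pos_of_pos (hx m) _

lemma Wk_one_le_xe {d : ℕ} {x : Fin d → ℝ} (hx : x ∈ Splx d) (m : Fin (d+1)) :
    Wk (fun _ : Fin (d+1) => 1) x ≤ xe x m := by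
  have h := (mem_Splx_iff x).1 hx
  simp only [Wk_eq_prod_xe, Real.rpow_one]
  rw [← Finset.mul_prod_erase _ _ (Finset.mem_univ m)]
  exact mul_le_of_le_one_right (h m)
    (Finset.prod_le_one (fun i _ => h i) fun i _ => xe_le_one hx i)

lemma IsEdgeDir.integral_eq_zero {d : ℕ} {k l : Fin (d+1)} {v : Fin d → ℝ}
    (hv : IsEdgeDir k l v) {κ : Fin (d+1) → ℝ} (hκ : ∀ i, -1 < κ i) {h h' : (Fin d → ℝ) → ℝ}
    (hh : ContinuousOn h (Splx d)) (hh' : ContinuousOn h' (Splx d))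
    (hd : ∀ x ∈ openSplx d, HasLineDerivAt ℝ h (h' x) x v) :
    ∫ x in openSplx d, (xe x k * xe x l * h' x
      + ((κ k + 1) * xe x l - (κ l + 1) * xe x k) * h x) * Wk κ x = 0 := by
  obtain ⟨χ, χ', C, hχ, hχ', hχd, hχ1, hC, hχ0, hχ2, hχ2'⟩ := exists_smooth_cutoff
  set U := openSplx d with hU
  have hUm : MeasurableSet U := (isOpen_openSplx d).measurableSet
  set p : (Fin d → ℝ) → ℝ := Wk fun _ : Fin (d+1) => 1 with hp
  set G : (Fin d → ℝ) → ℝ := fun x => xe x k * xe x l * h' x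
    + ((κ k + 1) * xe x l - (κ l + 1) * xe x k) * h x with hG
  set H : (Fin d → ℝ) → ℝ := fun x => (xe x l - xe x k) * h x with hH
  have hxc : ∀ m, ContinuousOn (fun x : Fin d → ℝ => xe x m) (Splx d) :=
    fun m => (continuous_xe m).continuousOn
  have hGc : ContinuousOn G (Splx d) :=
    (((hxc k).mul (hxc l)).mul hh').add (((continuousOn_const.mul (hxc l)).sub
      (continuousOn_const.mul (hxc k))).mul hh)
  have hHc : ContinuousOn H (Splx d) := ((hxc l).sub (hxc k)).mul hh
  have hKc : ContinuousOn (fun x => xe x k * xe x l * h x) (Splx d) :=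
    ((hxc k).mul (hxc l)).mul hh
  have hGI := integrableOn_mul_Wk hκ hGc
  have hHI := integrableOn_mul_Wk hκ hHc
  have hKI := integrableOn_mul_Wk hκ hKc
  have hpc : ContinuousOn p U := continuousOn_Wk _
  set F : ℕ → (Fin d → ℝ) → ℝ := fun n =>
    U.indicator fun x => χ (n * p x) * (xe x k * xe x l * h x * Wk κ x) with hF
  set F' : ℕ → (Fin d → ℝ) → ℝ := fun n => U.indicator fun x =>
    χ (n * p x) * (G x * Wk κ x) + (n * p x * χ' (n * p x)) * (H x * Wk κ x) with hF'
  have hnp : ∀ n : ℕ, ContinuousOn (fun x => n * p x) U := fun n => continuousOn_const.mul hpc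
  have hχm : ∀ n : ℕ, AEStronglyMeasurable (fun x => χ (n * p x)) (volume.restrict U) := fun n =>
    (hχ.comp_continuousOn (hnp n)).aestronglyMeasurable hUm
  have hχm' : ∀ n : ℕ, AEStronglyMeasurable (fun x => n * p x * χ' (n * p x))
      (volume.restrict U) := fun n =>
    ((hnp n).mul (hχ'.comp_continuousOn (hnp n))).aestronglyMeasurable hUm
  have hFI : ∀ n, Integrable (F n) := fun n => (integrable_indicator_iff hUm).2 <|
    Integrable.bdd_mul (c := 1) hKI (hχm n) (ae_of_all _ fun x => hχ1 _)
  have hF'I1 : ∀ n : ℕ, IntegrableOn (fun x => χ (n * p x) * (G x * Wk κ x)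
      + (n * p x * χ' (n * p x)) * (H x * Wk κ x)) U := fun n =>
    (Integrable.bdd_mul (c := 1) hGI (hχm n) (ae_of_all _ fun x => hχ1 _)).add
      (Integrable.bdd_mul (c := C) hHI (hχm' n) (ae_of_all _ fun x => hC _))
  have hF'I : ∀ n, Integrable (F' n) := fun n => (integrable_indicator_iff hUm).2 (hF'I1 n)
  have hderiv : ∀ n x, HasLineDerivAt ℝ (F n) (F' n x) x v := by
    intro n x
    by_cases hx : x ∈ U
    · have hev : ∀ᶠ y in 𝓝 x, y ∈ U := (isOpen_openSplx d).mem_nhds hx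
      have h1 : HasLineDerivAt ℝ (fun y => χ (n * p y))
          (χ' (n * p x) * (n * (p x * (1 / xe x k - 1 / xe x l)))) x v := by
        have h2 := hv.hasLineDerivAt_Wk (fun _ => 1) hx
        simp only [HasLineDerivAt] at h2 ⊢
        have h3 : HasDerivAt χ (χ' (n * p x)) (n * p (x + (0 : ℝ) • v)) := by
          simpa using hχd (n * p x)
        exact h3.comp (0 : ℝ) (h2.const_mul (n : ℝ))
      have h4 := h1.fun_mul ((hv.hasLineDerivAt_mul_Wk κ hx).fun_mul (hd x hx))
      have h5 : HasLineDerivAt ℝ (fun y => χ (n * p y) * (xe y k * xe y l * h y * Wk κ y))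
          (F' n x) x v := by
        have hxk := (hx k).ne'
        have hxl := (hx l).ne'
        have e1 : F' n x = χ (n * p x) * (G x * Wk κ x)
          + (n * p x * χ' (n * p x)) * (H x * Wk κ x) := Set.indicator_of_mem hx _
        rw [e1]
        simp only [HasLineDerivAt] at h4 ⊢
        refine (h4.congr_deriv ?_).congr_of_eventuallyEq (.of_forall fun t => ?_)
        · simp only [hG, hH, zero_smul, add_zero]
          field_simp
          ring
        · simp only; ring
      refine h5.congr_of_eventuallyEq (hev.mono fun y hy => ?_)
      exact Set.indicator_of_mem hy _
    · have hx' : ∃ m, xe x m ≤ 0 := by simpa [hU, openSplx] using hx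
      obtain ⟨m, hm⟩ := hx'
      have hlt : n * xe x m < 1 :=
        (mul_nonpos_of_nonneg_of_nonpos n.cast_nonneg hm).trans_lt one_pos
      have hev : ∀ᶠ y in 𝓝 x, n * xe y m < 1 :=
        (continuous_const.mul (continuous_xe m)).continuousAt.eventually_lt_const hlt
      have e1 : F' n x = 0 := Set.indicator_of_notMem hx _
      rw [e1]
      have h0 : HasLineDerivAt ℝ (fun _ : Fin d → ℝ => (0 : ℝ)) 0 x v := by
        simp [HasLineDerivAt, hasDerivAt_const]
      refine h0.congr_of_eventuallyEq (hev.mono fun y hy => ?_)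
      refine Set.indicator_apply_eq_zero.2 fun hyU => ?_
      rw [hχ0 _ ((mul_le_mul_of_nonneg_left (Wk_one_le_xe (openSplx_subset d hyU) m)
        n.cast_nonneg).trans hy.le), zero_mul]
  have hzero : ∀ n : ℕ, ∫ x in U, (χ (n * p x) * (G x * Wk κ x)
      + (n * p x * χ' (n * p x)) * (H x * Wk κ x)) = 0 := by
    intro n
    rw [← integral_indicator hUm]
    have := integral_bilinear_hasLineDerivAt_right_eq_neg_left_of_integrable (μ := volume)
      (f := fun _ : Fin d → ℝ => (1 : ℝ)) (f' := fun _ => 0) (g := F n) (g' := F' n) (v := v)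
      (B := ContinuousLinearMap.mul ℝ ℝ) (by simp) (by simpa using hF'I n)
      (by simpa using hFI n) (fun x _ => by simp [HasLineDerivAt, hasDerivAt_const]) (fun x _ => hderiv n x)
    simpa using this
  have hlim := tendsto_integral_of_dominated_convergence (μ := volume.restrict U)
    (F := fun n : ℕ => fun x => χ (n * p x) * (G x * Wk κ x)
      + (n * p x * χ' (n * p x)) * (H x * Wk κ x)) (f := fun x => G x * Wk κ x)
    (fun x => ‖G x * Wk κ x‖ + C * ‖H x * Wk κ x‖)
    (fun n => (hF'I1 n).aestronglyMeasurable) (hGI.norm.add (hHI.norm.const_mul C))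
    (fun n => ae_of_all _ fun x => by
      refine (norm_add_le _ _).trans (add_le_add ?_ ?_)
      · rw [norm_mul]
        exact mul_le_of_le_one_left (norm_nonneg _) (hχ1 _)
      · rw [norm_mul]
        exact mul_le_mul_of_nonneg_right (hC _) (norm_nonneg _))
    ((ae_restrict_iff' hUm).2 (ae_of_all _ fun x hx => by
      refine tendsto_const_nhds.congr' ?_
      have : Tendsto (fun n : ℕ => n * p x) atTop atTop :=
        tendsto_natCast_atTop_atTop.atTop_mul_const (Wk_one_pos hx)
      filter_upwards [this.eventually_gt_atTop 2] with n hn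
      rw [hχ2 _ hn, hχ2' _ hn]
      ring))
  simp only [hzero] at hlim
  exact tendsto_nhds_unique hlim tendsto_const_nhds

lemma hasFDerivAt_of_contDiffOn_Splx {d : ℕ} {f : (Fin d → ℝ) → ℝ} {n : WithTop ℕ∞}
    (hf : ContDiffOn ℝ n f (Splx d)) (hn : n ≠ 0) {x : Fin d → ℝ} (hx : x ∈ openSplx d) :
    HasFDerivAt f (fderivWithin ℝ f (Splx d) x) x :=
  ((hf.differentiableOn hn x (openSplx_subset d hx)).hasFDerivWithinAt).hasFDerivAt
    (mem_interior_iff_mem_nhds.1 (openSplx_subset_interior d hx))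

lemma ContDiffOn.fderivWithin_Splx_apply {d : ℕ} {f : (Fin d → ℝ) → ℝ} {m n : WithTop ℕ∞}
    (hf : ContDiffOn ℝ n f (Splx d)) (hmn : m + 1 ≤ n) (v : Fin d → ℝ) :
    ContDiffOn ℝ m (fun x => fderivWithin ℝ f (Splx d) x v) (Splx d) :=
  (hf.fderivWithin (uniqueDiffOn_Splx d) hmn).clm_apply contDiffOn_const

lemma fderiv_fderiv_apply_eq_fderivWithin {d : ℕ} {f : (Fin d → ℝ) → ℝ}
    (hf : ContDiffOn ℝ 2 f (Splx d)) {x : Fin d → ℝ} (hx : x ∈ openSplx d) (v : Fin d → ℝ) :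
    fderiv ℝ (fun y => fderiv ℝ f y v) x v
      = fderivWithin ℝ (fun y => fderivWithin ℝ f (Splx d) y v) (Splx d) x v := by
  have hev : (fun y => fderiv ℝ f y v) =ᶠ[𝓝 x] fun y => fderivWithin ℝ f (Splx d) y v := by
    filter_upwards [(isOpen_openSplx d).mem_nhds hx] with y hy
    rw [(hasFDerivAt_of_contDiffOn_Splx hf two_ne_zero hy).fderiv]
  rw [hev.fderiv_eq, (hasFDerivAt_of_contDiffOn_Splx
    (hf.fderivWithin_Splx_apply (m := 1) one_add_one_eq_two.le v) one_ne_zero hx).fderiv]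

/-- Integration by parts along an edge direction of the simplex. -/
lemma IsEdgeDir.integral_by_parts {d : ℕ} {k l : Fin (d+1)} {v : Fin d → ℝ}
    (hv : IsEdgeDir k l v) {κ : Fin (d+1) → ℝ} (hκ : ∀ i, -1 < κ i) {f g : (Fin d → ℝ) → ℝ}
    (hf : ContDiffOn ℝ 2 f (Splx d)) (hg : ContDiffOn ℝ 2 g (Splx d)) :
    IntegrableOn (fun x => (xe x k * xe x l * fderiv ℝ (fun y => fderiv ℝ f y v) x v
      + ((κ k + 1) * xe x l - (κ l + 1) * xe x k) * fderiv ℝ f x v) * g x * Wk κ x)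
      (openSplx d) ∧
    ∫ x in openSplx d, xe x k * xe x l * fderiv ℝ f x v * fderiv ℝ g x v * Wk κ x =
      -∫ x in openSplx d, (xe x k * xe x l * fderiv ℝ (fun y => fderiv ℝ f y v) x v
      + ((κ k + 1) * xe x l - (κ l + 1) * xe x k) * fderiv ℝ f x v) * g x * Wk κ x := by
  have hUm : MeasurableSet (openSplx d) := (isOpen_openSplx d).measurableSet
  set S := Splx d with hS
  have hf1 := hf.fderivWithin_Splx_apply (m := 1) one_add_one_eq_two.le v
  have hg1 := hg.fderivWithin_Splx_apply (m := 1) one_add_one_eq_two.le v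
  have hf2 := hf1.fderivWithin_Splx_apply (m := 0) (zero_add 1).le v
  rw [← hS] at hf1 hg1 hf2
  have hxc : ∀ m, ContinuousOn (fun x : Fin d → ℝ => xe x m) S :=
    fun m => (continuous_xe m).continuousOn
  have hA := integrableOn_mul_Wk hκ
    ((((hxc k).mul (hxc l)).mul hf1.continuousOn).mul hg1.continuousOn)
  have hB := integrableOn_mul_Wk hκ ((((((hxc k).mul (hxc l)).mul hf2.continuousOn).add
    (((continuousOn_const (c := κ k + 1)).mul (hxc l)).sub
      ((continuousOn_const (c := κ l + 1)).mul (hxc k)) |>.mul hf1.continuousOn))).mul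
        hg.continuousOn)
  have hzero := hv.integral_eq_zero hκ (hf1.continuousOn.mul hg.continuousOn)
    ((hf2.continuousOn.mul hg.continuousOn).add (hf1.continuousOn.mul hg1.continuousOn))
    (fun x hx => by
      have h1 := (hasFDerivAt_of_contDiffOn_Splx hf1 one_ne_zero hx).hasLineDerivAt v
      have h2 := (hasFDerivAt_of_contDiffOn_Splx hg two_ne_zero hx).hasLineDerivAt v
      have h3 := h1.fun_mul h2
      simp only [HasLineDerivAt] at h3 ⊢
      refine h3.congr_deriv ?_
      simp only [zero_smul, add_zero, hS, Pi.mul_apply, Pi.add_apply])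
  have hBeq : ∀ x ∈ openSplx d, (xe x k * xe x l * fderiv ℝ (fun y => fderiv ℝ f y v) x v
      + ((κ k + 1) * xe x l - (κ l + 1) * xe x k) * fderiv ℝ f x v) * g x * Wk κ x =
      (xe x k * xe x l * fderivWithin ℝ (fun y => fderivWithin ℝ f S y v) S x v
      + ((κ k + 1) * xe x l - (κ l + 1) * xe x k) * fderivWithin ℝ f S x v) * g x * Wk κ x :=
    fun x hx => by
      rw [fderiv_fderiv_apply_eq_fderivWithin hf hx,
        (hasFDerivAt_of_contDiffOn_Splx hf two_ne_zero hx).fderiv]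
  refine ⟨hB.congr_fun (fun x hx => (hBeq x hx).symm) hUm, ?_⟩
  rw [setIntegral_congr_fun hUm hBeq, eq_neg_iff_add_eq_zero,
    setIntegral_congr_fun hUm (g := fun x => xe x k * xe x l * fderivWithin ℝ f S x v
      * fderivWithin ℝ g S x v * Wk κ x) fun x hx => by
        simp only [(hasFDerivAt_of_contDiffOn_Splx hf two_ne_zero hx).fderiv,
          (hasFDerivAt_of_contDiffOn_Splx hg two_ne_zero hx).fderiv, hS]]
  refine (integral_add hA hB).symm.trans (Eq.trans ?_ hzero)
  refine integral_congr_ae (ae_of_all _ fun x => ?_)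
  simp only [Pi.mul_apply, Pi.add_apply, Pi.sub_apply]
  ring

lemma isEdgeDir_castSucc_last {d : ℕ} (i : Fin d) :
    IsEdgeDir i.castSucc (Fin.last d) (Pi.single i 1) := by
  refine ⟨(Fin.castSucc_lt_last i).ne, fun m => ?_⟩
  induction m using Fin.lastCases with
  | last => simp [xeLin, (Fin.castSucc_lt_last i).ne']
  | cast j => simp [xeLin, Pi.single_apply, (Fin.castSucc_lt_last j).ne]

lemma isEdgeDir_castSucc_castSucc {d : ℕ} {i j : Fin d} (hij : i ≠ j) :
    IsEdgeDir i.castSucc j.castSucc (Pi.single i 1 - Pi.single j 1) := by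
  refine ⟨by simpa using hij, fun m => ?_⟩
  rw [map_sub, (isEdgeDir_castSucc_last i).2, (isEdgeDir_castSucc_last j).2]
  ring

lemma sum_sum_filter_lt_add_swap {ι M : Type*} [Fintype ι] [LinearOrder ι] [AddCommMonoid M]
    (u : ι → ι → M) :
    (∑ i, ∑ j ∈ Finset.univ.filter (fun j => i < j), (u i j + u j i)) + ∑ i, u i i
      = ∑ i, ∑ j, u i j := by
  have h1 : ∑ i, ∑ j, (if i < j then u j i else 0) = ∑ i, ∑ j, (if j < i then u i j else 0) :=
    Finset.sum_comm
  have h2 : ∀ i, u i i = ∑ j, (if i = j then u i j else 0) := fun i => by simp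
  simp only [Finset.sum_filter, Finset.sum_add_distrib]
  rw [h1, Finset.sum_congr rfl fun i _ => h2 i, ← Finset.sum_add_distrib, ← Finset.sum_add_distrib]
  refine Finset.sum_congr rfl fun i _ => ?_
  rw [← Finset.sum_add_distrib, ← Finset.sum_add_distrib]
  refine Finset.sum_congr rfl fun j _ => ?_
  rcases lt_trichotomy i j with h | h | h
  · simp [h, h.not_gt, h.ne]
  · simp [h]
  · simp [h, h.not_gt, h.ne']

lemma fderiv_fderiv_apply {d : ℕ} {f : (Fin d → ℝ) → ℝ} (hf : ContDiffOn ℝ 2 f (Splx d))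
    {x : Fin d → ℝ} (hx : x ∈ openSplx d) (v w : Fin d → ℝ) :
    fderiv ℝ (fun y => fderiv ℝ f y v) x w = fderiv ℝ (fderiv ℝ f) x w v := by
  have hfx : ContDiffAt ℝ 2 f x :=
    hf.contDiffAt (mem_interior_iff_mem_nhds.1 (openSplx_subset_interior d hx))
  have hd : DifferentiableAt ℝ (fderiv ℝ f) x :=
    (hfx.fderiv_right (m := 1) one_add_one_eq_two.le).differentiableAt one_ne_zero
  rw [fderiv_clm_apply hd (differentiableAt_const v)]
  simp

/-- The self-adjoint form of the spectral operator. -/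
lemma Dk_eq_sum_edgeDir {d : ℕ} (κ : Fin (d+1) → ℝ) {f : (Fin d → ℝ) → ℝ}
    (hf : ContDiffOn ℝ 2 f (Splx d)) {x : Fin d → ℝ} (hx : x ∈ openSplx d) :
    Dk κ f x = (∑ i : Fin d, (xe x i.castSucc * xe x (Fin.last d)
        * fderiv ℝ (fun y => fderiv ℝ f y (Pi.single i 1)) x (Pi.single i 1)
      + ((κ i.castSucc + 1) * xe x (Fin.last d) - (κ (Fin.last d) + 1) * xe x i.castSucc)
        * fderiv ℝ f x (Pi.single i 1)))
      + ∑ i : Fin d, ∑ j ∈ Finset.univ.filter (fun j => i < j),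
        (xe x i.castSucc * xe x j.castSucc
        * fderiv ℝ (fun y => fderiv ℝ f y (Pi.single i 1 - Pi.single j 1)) x
          (Pi.single i 1 - Pi.single j 1)
      + ((κ i.castSucc + 1) * xe x j.castSucc - (κ j.castSucc + 1) * xe x i.castSucc)
        * fderiv ℝ f x (Pi.single i 1 - Pi.single j 1)) := by
  have hfx : ContDiffAt ℝ 2 f x :=
    hf.contDiffAt (mem_interior_iff_mem_nhds.1 (openSplx_subset_interior d hx))
  have hsymm := hfx.isSymmSndFDerivAt (by simp)
  have hpd2 : ∀ i j, pd i (pd j f) x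
      = fderiv ℝ (fderiv ℝ f) x (Pi.single i 1) (Pi.single j 1) := fun i j =>
    fderiv_fderiv_apply hf hx _ _
  simp only [Dk, hpd2]
  simp only [fderiv_fderiv_apply hf hx, xe_castSucc, xe_last]
  simp only [map_sub, sub_apply]
  set a : Fin d → ℝ := fun i => fderiv ℝ f x (Pi.single i 1) with ha
  set H : Fin d → Fin d → ℝ := fun i j =>
    fderiv ℝ (fderiv ℝ f) x (Pi.single i 1) (Pi.single j 1) with hH
  have hHs : ∀ i j, H j i = H i j := fun i j => hsymm _ _
  set u : Fin d → Fin d → ℝ := fun i j => x i * x j * H i i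
    + ((κ i.castSucc + 1) * x j - (κ j.castSucc + 1) * x i) * a i with hu
  have key := sum_sum_filter_lt_add_swap u
  have hrow : ∀ i, ∑ j, u i j = x i * (∑ j, x j) * H i i + ((κ i.castSucc + 1) * (∑ j, x j)
      - ((∑ j : Fin d, κ j.castSucc) + d) * x i) * a i := fun i => by
    simp only [hu, Finset.sum_add_distrib, ← Finset.sum_mul, Finset.sum_sub_distrib,
      ← Finset.mul_sum]
    simp
  have hsplit : ∀ i j, x i * x j * (H i i - H j i - (H i j - H j j))
      + ((κ i.castSucc + 1) * x j - (κ j.castSucc + 1) * x i) * (a i - a j)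
      = (u i j + u j i) - 2 * (x i * x j * H i j) := fun i j => by
    simp only [hu, hHs i j]; ring
  simp only [hrow] at key
  change (∑ i, x i * (1 - x i) * H i i)
    - 2 * ∑ i, ∑ j ∈ Finset.univ.filter (fun j => i < j), x i * x j * H i j
    + ∑ i, (κ i.castSucc + 1 - ((∑ k, κ k) + (d : ℝ) + 1) * x i) * a i = _ + _
  have hR : ∑ i, ∑ j ∈ Finset.univ.filter (fun j => i < j),
      (x i * x j * (H i i - H j i - (H i j - H j j))
      + ((κ i.castSucc + 1) * x j - (κ j.castSucc + 1) * x i) * (a i - a j))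
      = (∑ i, ∑ j ∈ Finset.univ.filter (fun j => i < j), (u i j + u j i))
        - 2 * ∑ i, ∑ j ∈ Finset.univ.filter (fun j => i < j), x i * x j * H i j := by
    simp only [hsplit, Finset.sum_sub_distrib, Finset.mul_sum]
  refine Eq.trans ?_ (congrArg _ hR.symm)
  rw [eq_sub_of_add_eq key, ← Finset.sum_sub_distrib, ← add_sub_assoc, ← Finset.sum_add_distrib,
    sub_add_eq_add_sub, ← Finset.sum_add_distrib]
  congr 1
  refine Finset.sum_congr rfl fun i _ => ?_
  simp only [hu, Fin.sum_univ_castSucc (n := d)]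
  ring

lemma pdd_eq_fderiv {d : ℕ} (i j : Fin d) (f : (Fin d → ℝ) → ℝ) (x : Fin d → ℝ) :
    pdd i j f x = fderiv ℝ f x (Pi.single i 1 - Pi.single j 1) :=
  (map_sub _ _ _).symm

end

/-- self-adjoint integration of the spectral operator `D_κ`. -/
theorem stmt1 (d : ℕ) (hd : 2 ≤ d) (κ : Fin (d+1) → ℝ) (hκ : ∀ i, -1 < κ i)
    (f g : (Fin d → ℝ) → ℝ)
    (hf : ContDiffOn ℝ 2 f (Splx d)) (hg : ContDiffOn ℝ 2 g (Splx d)) :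
    -∫ x in Splx d, Dk κ f x * g x * Wk κ x =
      (∑ i, ∫ x in Splx d, x i * (1 - ∑ k, x k) * pd i f x * pd i g x * Wk κ x) +
      ∑ i, ∑ j ∈ Finset.univ.filter (fun j => i < j),
        ∫ x in Splx d, x i * x j * pdd i j f x * pdd i j g x * Wk κ x := by
  have hd0 : 0 < d := by lia
  have h1 := fun i => (isEdgeDir_castSucc_last i).integral_by_parts hκ hf hg
  have h2 := fun (i j : Fin d) (hij : i < j) =>
    (isEdgeDir_castSucc_castSucc hij.ne).integral_by_parts hκ hf hg
  simp only [← setIntegral_congr_set (openSplx_ae_eq_Splx hd0), pdd_eq_fderiv]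
  have e1 := Finset.sum_congr (rfl : (Finset.univ : Finset (Fin d)) = _) fun i _ => (h1 i).2
  have e2 := Finset.sum_congr (rfl : (Finset.univ : Finset (Fin d)) = _) fun i _ =>
    Finset.sum_congr (rfl : Finset.univ.filter (fun j => i < j) = _) fun j hj =>
      (h2 i j (Finset.mem_filter.1 hj).2).2
  have hI1 := integrable_finsetSum Finset.univ fun i _ => (h1 i).1
  have hI2 := integrable_finsetSum Finset.univ fun i _ =>
    integrable_finsetSum (Finset.univ.filter fun j => i < j) fun j hj =>
      (h2 i j (Finset.mem_filter.1 hj).2).1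
  simp only [Finset.sum_neg_distrib] at e1 e2
  rw [← integral_finsetSum _ fun i _ => (h1 i).1] at e1
  rw [← Finset.sum_congr rfl fun i _ => integral_finsetSum _ fun j hj =>
      (h2 i j (Finset.mem_filter.1 hj).2).1,
    ← integral_finsetSum _ fun i _ => integrable_finsetSum _ fun j hj =>
      (h2 i j (Finset.mem_filter.1 hj).2).1] at e2
  have e3 := congrArg₂ (· + ·) e1 e2
  simp only [← neg_add] at e3
  rw [← integral_add hI1 hI2] at e3
  simp only [xe_castSucc, xe_last] at e3
  refine Eq.trans ?_ e3.symm
  rw [neg_inj]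
  refine setIntegral_congr_fun (isOpen_openSplx d).measurableSet fun x hx => ?_
  simp only [Dk_eq_sum_edgeDir κ hf hx, add_mul, Finset.sum_mul, Finset.sum_add_distrib,
    xe_castSucc, xe_last]
end
end

section
/- For d ≥ 2, κ_i > −1 (i = 1,…,d+1) and n ∈ ℕ_0: every polynomial f in d variables of degree at most n satisfies Σ_{i=1}^d ‖ √(x_i(1−|x|)) ∂_i f ‖_{κ,2}² ≤ n(n+|κ|+d) ‖f‖_{κ,2}², and this inequality is sharp: there exists a nonzero polynomial f of degree exactly n for which equality holds. -/
open MeasureTheory Finset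

noncomputable section

/-- The quantity `Σ_i ‖√(x_i(1-|x|)) ∂_i f‖²_{κ,2}`. -/
def aform {d : ℕ} (κ : Fin (d+1) → ℝ) (F : (Fin d → ℝ) → ℝ) : ℝ :=
  ∑ i, nrm2 κ (fun x => Real.sqrt (x i * (1 - ∑ k, x k)) * pd i F x) ^ 2


namespace SimplexJacobi

open MvPolynomial

section Algebra

variable {σ : Type*} [Fintype σ]

/-- The Euler operator `∑ x_i ∂_i` as a derivation on polynomials. -/
def euler : Derivation ℝ (MvPolynomial σ ℝ) (MvPolynomial σ ℝ) :=
  ∑ i, (X i : MvPolynomial σ ℝ) • pderiv i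

lemma euler_apply (f : MvPolynomial σ ℝ) : euler f = ∑ i, X i * pderiv i f := by
  exact (congrFun (map_sum Derivation.coeFnAddMonoidHom
    (fun i => (X i : MvPolynomial σ ℝ) • pderiv i) Finset.univ) f).trans (by simp)

lemma euler_mul (f g : MvPolynomial σ ℝ) : euler (f * g) = f * euler g + g * euler f := by
  simp [Derivation.leibniz]

lemma euler_X (i : σ) : euler (X i : MvPolynomial σ ℝ) = X i := by
  classical
  simp [euler_apply, Pi.single_apply]

lemma euler_of_isHomogeneous {f : MvPolynomial σ ℝ} {n : ℕ} (hf : f.IsHomogeneous n) :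
    euler f = (n : ℝ) • f := by
  rw [euler_apply, hf.sum_X_mul_pderiv, Nat.cast_smul_eq_nsmul]

/-- The negative of the Jacobi operator on the simplex, acting on polynomials;
`c` stands for `|κ| + d` and `a i` for `κ i + 1`. -/
def jacobiOp (c : ℝ) (a : σ → ℝ) : MvPolynomial σ ℝ →ₗ[ℝ] MvPolynomial σ ℝ :=
  (euler : Derivation ℝ (MvPolynomial σ ℝ) (MvPolynomial σ ℝ)).toLinearMap ∘ₗ
      (euler : Derivation ℝ (MvPolynomial σ ℝ) (MvPolynomial σ ℝ)).toLinearMap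
    + c • (euler : Derivation ℝ (MvPolynomial σ ℝ) (MvPolynomial σ ℝ)).toLinearMap
    - ∑ i, (LinearMap.mulLeft ℝ (X i) ∘ₗ (pderiv i).toLinearMap ∘ₗ (pderiv i).toLinearMap
      + a i • (pderiv i).toLinearMap)

lemma jacobiOp_apply (c : ℝ) (a : σ → ℝ) (f : MvPolynomial σ ℝ) :
    jacobiOp c a f = euler (euler f) + c • euler f
      - ∑ i, (X i * pderiv i (pderiv i f) + a i • pderiv i f) := by
  simp [jacobiOp]

/-- The gradient form `∑ x_i ∂_i f ∂_i g - ⟨x,∇f⟩⟨x,∇g⟩` attached to the Jacobi operator. -/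
def carre (f g : MvPolynomial σ ℝ) : MvPolynomial σ ℝ :=
  ∑ i, X i * pderiv i f * pderiv i g - euler f * euler g

/-- The eigenvalue of the Jacobi operator on polynomials of degree `n`. -/
def eig (c : ℝ) (n : ℕ) : ℝ := n * (n + c)

lemma jacobiOp_monomial_sub_mem (c : ℝ) (a : σ → ℝ) (n : ℕ) (s : σ →₀ ℕ) (r : ℝ)
    (hs : s.degree ≤ n + 1) :
    jacobiOp c a (monomial s r) - eig c (n + 1) • monomial s r ∈
      restrictTotalDegree σ ℝ n := by
  have hh : (monomial s r).IsHomogeneous s.degree := isHomogeneous_monomial r rfl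
  have hd (i : σ) : pderiv i (monomial s r) ∈ restrictTotalDegree σ ℝ n := by
    rw [mem_restrictTotalDegree]
    exact (hh.pderiv (i := i)).totalDegree_le.trans (by omega)
  have hterm (i : σ) : X i * pderiv i (pderiv i (monomial s r)) + a i • pderiv i (monomial s r)
      ∈ restrictTotalDegree σ ℝ n := by
    refine add_mem ?_ (Submodule.smul_mem _ _ (hd i))
    have h := hd i
    rw [pderiv_monomial] at h ⊢
    rw [X_mul_pderiv_monomial]
    exact nsmul_mem h _
  have he : euler (euler (monomial s r)) + c • euler (monomial s r)
      = eig c s.degree • monomial s r := by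
    rw [euler_of_isHomogeneous hh, Derivation.map_smul, euler_of_isHomogeneous hh, smul_smul,
      smul_smul, ← add_smul, eig]
    ring_nf
  rw [jacobiOp_apply, he, sub_right_comm, ← sub_smul]
  refine sub_mem ?_ (Submodule.sum_mem _ fun i _ => hterm i)
  rcases hs.eq_or_lt with h | h
  · simp [h]
  · refine Submodule.smul_mem _ _ ?_
    rw [mem_restrictTotalDegree]
    exact hh.totalDegree_le.trans (by omega)

lemma jacobiOp_sub_mem (c : ℝ) (a : σ → ℝ) {n : ℕ} {f : MvPolynomial σ ℝ}
    (hf : f.totalDegree ≤ n + 1) :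
    jacobiOp c a f - eig c (n + 1) • f ∈ restrictTotalDegree σ ℝ n := by
  have h : jacobiOp c a f - eig c (n + 1) • f = ∑ s ∈ f.support,
      (jacobiOp c a (monomial s (coeff s f)) - eig c (n + 1) • monomial s (coeff s f)) := by
    rw [Finset.sum_sub_distrib, ← map_sum, ← Finset.smul_sum, ← f.as_sum]
  rw [h]
  refine Submodule.sum_mem _ fun s hs => jacobiOp_monomial_sub_mem c a n s _ ?_
  exact (le_totalDegree hs).trans hf

lemma jacobiOp_mem (c : ℝ) (a : σ → ℝ) {n : ℕ} {f : MvPolynomial σ ℝ}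
    (hf : f ∈ restrictTotalDegree σ ℝ n) : jacobiOp c a f ∈ restrictTotalDegree σ ℝ n := by
  have h : f.totalDegree ≤ n := (mem_restrictTotalDegree _ _ _).1 hf
  cases n with
  | zero =>
    obtain ⟨r, rfl⟩ : ∃ r, f = C r := ⟨_, totalDegree_eq_zero_iff_eq_C.1 (Nat.le_zero.1 h)⟩
    simp [jacobiOp_apply, euler_apply]
  | succ n =>
    have h1 := jacobiOp_sub_mem c a h
    have h2 : jacobiOp c a f - eig c (n + 1) • f ∈ restrictTotalDegree σ ℝ (n + 1) := by
      rw [mem_restrictTotalDegree] at h1 ⊢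
      omega
    simpa using add_mem h2 (Submodule.smul_mem _ (eig c (n + 1)) hf)

/-- The sum of all variables. -/
def sumX : MvPolynomial σ ℝ := ∑ i, X i

lemma pderiv_sumX (i : σ) : pderiv i (sumX : MvPolynomial σ ℝ) = 1 := by
  classical
  simp [sumX, Pi.single_apply]

lemma isHomogeneous_sumX_pow (k : ℕ) : ((sumX : MvPolynomial σ ℝ) ^ k).IsHomogeneous k := by
  simpa [sumX] using (IsHomogeneous.sum Finset.univ _ 1 fun i _ => isHomogeneous_X ℝ i).pow k

lemma pderiv_sumX_pow (i : σ) (k : ℕ) :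
    pderiv i ((sumX : MvPolynomial σ ℝ) ^ k) = (k : ℝ) • sumX ^ (k - 1) := by
  rw [pderiv_pow, pderiv_sumX, mul_one, smul_eq_C_mul]
  simp

lemma jacobiOp_sumX_pow (c : ℝ) (a : σ → ℝ) (k : ℕ) :
    jacobiOp c a (sumX ^ k) = eig c k • sumX ^ k
      - ((k : ℝ) * ((k - 1 : ℕ) + ∑ i, a i)) • sumX ^ (k - 1) := by
  have hh := isHomogeneous_sumX_pow (σ := σ) k
  have he : euler (euler ((sumX : MvPolynomial σ ℝ) ^ k)) + c • euler (sumX ^ k)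
      = eig c k • sumX ^ k := by
    rw [euler_of_isHomogeneous hh, Derivation.map_smul, euler_of_isHomogeneous hh, smul_smul,
      smul_smul, ← add_smul, eig]
    ring_nf
  have hq : ∑ i, X i * pderiv i (pderiv i ((sumX : MvPolynomial σ ℝ) ^ k))
      = ((k : ℝ) * (k - 1 : ℕ)) • sumX ^ (k - 1) := by
    rw [mul_smul, ← euler_of_isHomogeneous (isHomogeneous_sumX_pow (k - 1)), euler_apply,
      Finset.smul_sum]
    refine Finset.sum_congr rfl fun i _ => ?_
    rw [pderiv_sumX_pow i k, Derivation.map_smul, mul_smul_comm]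
  rw [jacobiOp_apply, he, Finset.sum_add_distrib, hq]
  simp_rw [pderiv_sumX_pow, smul_smul]
  rw [← Finset.sum_smul, ← add_smul, ← Finset.sum_mul]
  ring_nf

variable {c : ℝ} {a : σ → ℝ} {L : MvPolynomial σ ℝ →ₗ[ℝ] ℝ}

/-- Integration by parts, derived from the moment relations. -/
lemma jacobiOp_green
    (hL : ∀ i p, L (X i * (euler p + (c + 1) • p)) = L (X i * pderiv i p + a i • p))
    (f g : MvPolynomial σ ℝ) : L (jacobiOp c a f * g) = L (carre f g) := by
  have h := Finset.sum_congr rfl fun i (_ : i ∈ Finset.univ) => hL i (pderiv i f * g)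
  rw [← map_sum, ← map_sum] at h
  have h1 : euler (euler f) = ∑ i, X i * euler (pderiv i f) + euler f := by
    rw [euler_apply f]
    simp only [map_sum, euler_mul, euler_X, Finset.sum_add_distrib]
    simp only [mul_comm]
  have h2 : ∑ i, X i * (euler (pderiv i f * g) + (c + 1) • (pderiv i f * g))
      = (euler (euler f) + c • euler f) * g + euler f * euler g := by
    have h3 : ∀ i, X i * (euler (pderiv i f * g) + (c + 1) • (pderiv i f * g))
        = (X i * euler (pderiv i f)) * g + (X i * pderiv i f) * (euler g + (c + 1) • g) := by
      intro i
      rw [euler_mul]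
      simp only [smul_eq_C_mul]
      ring
    rw [Finset.sum_congr rfl fun i _ => h3 i, Finset.sum_add_distrib, ← Finset.sum_mul,
      ← Finset.sum_mul, ← euler_apply f, h1]
    simp only [smul_eq_C_mul, map_add, map_one]
    ring
  have h4 : ∑ i, (X i * pderiv i (pderiv i f * g) + a i • (pderiv i f * g))
      = (∑ i, (X i * pderiv i (pderiv i f) + a i • pderiv i f)) * g
        + ∑ i, X i * pderiv i f * pderiv i g := by
    rw [Finset.sum_mul, ← Finset.sum_add_distrib]
    refine Finset.sum_congr rfl fun i _ => ?_
    rw [pderiv_mul]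
    simp only [smul_eq_C_mul]
    ring
  rw [h2, h4, map_add, map_add] at h
  rw [jacobiOp_apply, carre, sub_mul, map_sub, map_sub]
  linarith

lemma carre_comm (f g : MvPolynomial σ ℝ) : carre f g = carre g f := by
  simp only [carre, mul_right_comm, mul_comm (euler f)]

lemma jacobiOp_symm
    (hL : ∀ i p, L (X i * (euler p + (c + 1) • p)) = L (X i * pderiv i p + a i • p))
    (f g : MvPolynomial σ ℝ) : L (jacobiOp c a f * g) = L (f * jacobiOp c a g) := by
  rw [jacobiOp_green hL, carre_comm, ← jacobiOp_green hL, mul_comm]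

/-- Orthogonal projection onto a finite-dimensional space of polynomials. -/
lemma exists_mem_forall_orthogonal (hpos : ∀ p, p ≠ 0 → 0 < L (p * p))
    (U : Submodule ℝ (MvPolynomial σ ℝ)) [FiniteDimensional ℝ U] (f : MvPolynomial σ ℝ) :
    ∃ u ∈ U, ∀ w ∈ U, L ((f - u) * w) = 0 := by
  let B : MvPolynomial σ ℝ →ₗ[ℝ] Module.Dual ℝ U :=
    ((LinearMap.mul ℝ (MvPolynomial σ ℝ)).compr₂ L).compl₂ U.subtype
  have hB : ∀ p (w : U), B p w = L (p * w) := fun _ _ => rfl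
  have hinj : Function.Injective (B ∘ₗ U.subtype) := by
    rw [← LinearMap.ker_eq_bot, LinearMap.ker_eq_bot']
    intro u hu
    by_contra hne
    have h0 : L ((u : MvPolynomial σ ℝ) * u) = 0 := by
      rw [← hB, ← U.subtype_apply, ← LinearMap.comp_apply, hu, LinearMap.zero_apply]
    exact (hpos u (by simpa using hne)).ne' h0
  obtain ⟨u, hu⟩ := (LinearMap.injective_iff_surjective_of_finrank_eq_finrank
    Subspace.dual_finrank_eq.symm).1 hinj (B f)
  refine ⟨u, u.2, fun w hw => ?_⟩
  have h := congrArg (fun φ : Module.Dual ℝ U => φ ⟨w, hw⟩) hu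
  simp only [LinearMap.comp_apply, hB, U.subtype_apply] at h
  rw [sub_mul, map_sub, h, sub_self]

/-- An element orthogonal to an invariant subspace which is an eigenvector modulo that subspace
has the corresponding Rayleigh quotient. -/
lemma carre_self_of_orthogonal
    (hL : ∀ i p, L (X i * (euler p + (c + 1) • p)) = L (X i * pderiv i p + a i • p))
    {U : Submodule ℝ (MvPolynomial σ ℝ)} {v : MvPolynomial σ ℝ} {t : ℝ}
    (hv : jacobiOp c a v - t • v ∈ U) (ho : ∀ w ∈ U, L (v * w) = 0) :
    L (carre v v) = t * L (v * v) := by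
  have h := ho _ hv
  rw [mul_sub, map_sub, mul_comm v, jacobiOp_green hL, mul_smul_comm, map_smul, smul_eq_mul] at h
  linarith

lemma carre_add (u v : MvPolynomial σ ℝ) :
    carre (u + v) (u + v) = carre u u + 2 * carre u v + carre v v := by
  have h : ∑ i, X i * pderiv i u * pderiv i v = ∑ i, X i * pderiv i v * pderiv i u :=
    Finset.sum_congr rfl fun i _ => by ring
  simp only [carre, map_add, mul_add, add_mul, Finset.sum_add_distrib, h]
  ring

/-- The Rayleigh quotient bound on polynomials of degree at most `n`. -/
theorem carre_le (hc : -1 < c)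
    (hL : ∀ i p, L (X i * (euler p + (c + 1) • p)) = L (X i * pderiv i p + a i • p))
    (hpos : ∀ p, p ≠ 0 → 0 < L (p * p)) (n : ℕ) (f : MvPolynomial σ ℝ) (hf : f.totalDegree ≤ n) :
    L (carre f f) ≤ eig c n * L (f * f) := by
  have hnn : ∀ p, 0 ≤ L (p * p) := fun p => by
    rcases eq_or_ne p 0 with rfl | h
    · simp
    · exact (hpos p h).le
  induction n generalizing f with
  | zero =>
    obtain ⟨r, rfl⟩ : ∃ r, f = C r := ⟨_, totalDegree_eq_zero_iff_eq_C.1 (Nat.le_zero.1 hf)⟩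
    simp [carre, eig]
  | succ n ih =>
    obtain ⟨u, hu, ho⟩ := exists_mem_forall_orthogonal hpos (restrictTotalDegree σ ℝ n) f
    have hud : u.totalDegree ≤ n := (mem_restrictTotalDegree _ _ _).1 hu
    obtain ⟨v, rfl⟩ : ∃ v, f = v + u := ⟨f - u, by ring⟩
    simp only [add_sub_cancel_right] at ho
    have hvd : v.totalDegree ≤ n + 1 := by
      have := totalDegree_sub (v + u) u
      rw [add_sub_cancel_right] at this
      omega
    have hv := carre_self_of_orthogonal hL (jacobiOp_sub_mem c a hvd) ho
    have hvu : L (carre v u) = 0 := by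
      rw [← jacobiOp_green hL, jacobiOp_symm hL]
      exact ho _ (jacobiOp_mem c a hu)
    have hmono : eig c n ≤ eig c (n + 1) := by
      simp only [eig]
      push_cast
      nlinarith [(Nat.cast_nonneg n : (0 : ℝ) ≤ n)]
    have hsq : (v + u) * (v + u) = v * v + (2 : ℝ) • (v * u) + u * u := by
      rw [smul_eq_C_mul, map_ofNat]
      ring
    have h2 : (2 : MvPolynomial σ ℝ) * carre v u = (2 : ℝ) • carre v u := by
      rw [smul_eq_C_mul, map_ofNat]
    rw [carre_add, hsq, h2]
    simp only [map_add, map_smul, hv, hvu, ho u hu, smul_zero, add_zero]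
    nlinarith [ih u hud, mul_le_mul_of_nonneg_right hmono (hnn u)]

/-- A polynomial of degree `n` in the sum of the variables attaining the bound. -/
theorem exists_carre_eq [Nonempty σ]
    (hL : ∀ i p, L (X i * (euler p + (c + 1) • p)) = L (X i * pderiv i p + a i • p))
    (hpos : ∀ p, p ≠ 0 → 0 < L (p * p)) (n : ℕ) :
    ∃ f : MvPolynomial σ ℝ, f ≠ 0 ∧ f.totalDegree = n ∧
      (∀ i j, pderiv i f = pderiv j f) ∧ L (carre f f) = eig c n * L (f * f) := by
  cases n with
  | zero =>
    refine ⟨1, one_ne_zero, totalDegree_one, fun i j => by simp, ?_⟩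
    simp [carre, eig]
  | succ n =>
    let U : Submodule ℝ (MvPolynomial σ ℝ) :=
      Submodule.span ℝ ((fun k => sumX ^ k) '' Set.Iic n)
    have hmem : ∀ k ≤ n, sumX ^ k ∈ U := fun k hk => Submodule.subset_span ⟨k, hk, rfl⟩
    have : FiniteDimensional ℝ U := FiniteDimensional.span_of_finite ℝ ((Set.finite_Iic n).image _)
    obtain ⟨u, hu, ho⟩ := exists_mem_forall_orthogonal hpos U (sumX ^ (n + 1))
    have hAU : ∀ w ∈ U, jacobiOp c a w ∈ U := by
      intro w hw
      induction hw using Submodule.span_induction with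
      | mem x hx =>
        obtain ⟨k, hk, rfl⟩ := hx
        have hk : k ≤ n := hk
        simp only [jacobiOp_sumX_pow]
        exact sub_mem (Submodule.smul_mem _ _ (hmem k hk))
          (Submodule.smul_mem _ _ (hmem _ (by omega)))
      | zero => simp
      | add x y _ _ hx hy => rw [map_add]; exact add_mem hx hy
      | smul r x _ hx => rw [map_smul]; exact Submodule.smul_mem _ _ hx
    have hdU : ∀ w ∈ U, ∀ i j, pderiv i w = pderiv j w := by
      intro w hw i j
      induction hw using Submodule.span_induction with
      | mem x hx =>
        obtain ⟨k, hk, rfl⟩ := hx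
        simp only [pderiv_sumX_pow]
      | zero => simp
      | add x y _ _ hx hy => rw [map_add, map_add, hx, hy]
      | smul r x _ hx => rw [Derivation.map_smul, Derivation.map_smul, hx]
    have hUd : U ≤ restrictTotalDegree σ ℝ n := by
      refine Submodule.span_le.2 ?_
      rintro _ ⟨k, hk, rfl⟩
      exact (mem_restrictTotalDegree _ _ _).2 ((isHomogeneous_sumX_pow k).totalDegree_le.trans hk)
    have hud : u.totalDegree ≤ n := (mem_restrictTotalDegree _ _ _).1 (hUd hu)
    have hne : (sumX : MvPolynomial σ ℝ) ^ (n + 1) ≠ 0 := by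
      refine pow_ne_zero _ fun h => ?_
      have h1 := pderiv_sumX (Classical.arbitrary σ)
      rw [h, map_zero] at h1
      exact zero_ne_one h1
    have htop := (isHomogeneous_sumX_pow (n + 1)).totalDegree hne
    have hdeg : (sumX ^ (n + 1) - u).totalDegree = n + 1 := by
      rw [sub_eq_add_neg, totalDegree_add_eq_left_of_totalDegree_lt, htop]
      rw [totalDegree_neg, htop]
      omega
    refine ⟨sumX ^ (n + 1) - u, fun h => ?_, hdeg, fun i j => ?_, ?_⟩
    · rw [h, totalDegree_zero] at hdeg
      omega
    · rw [map_sub, map_sub, hdU u hu i j, pderiv_sumX_pow, pderiv_sumX_pow]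
    · refine carre_self_of_orthogonal hL ?_ ho
      have h : jacobiOp c a (sumX ^ (n + 1) - u) - eig c (n + 1) • (sumX ^ (n + 1) - u)
          = eig c (n + 1) • u - jacobiOp c a u
            - (((n + 1 : ℕ) : ℝ) * ((n : ℕ) + ∑ i, a i)) • sumX ^ n := by
        rw [map_sub, jacobiOp_sumX_pow, smul_sub, Nat.add_sub_cancel]
        abel
      rw [h]
      exact sub_mem (sub_mem (Submodule.smul_mem _ _ hu) (hAU u hu))
        (Submodule.smul_mem _ _ (hmem n le_rfl))

end Algebra

section Dirichlet

lemma lintegral_beta_scaled {a b s : ℝ} (ha : -1 < a) (hb : -1 < b) (hs : 0 < s) :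
    ∫⁻ t in Set.Ioo 0 s, ENNReal.ofReal (t ^ a * (s - t) ^ b) =
      ENNReal.ofReal (ProbabilityTheory.beta (a + 1) (b + 1) * s ^ (a + b + 1)) := by
  have hB : 0 < ProbabilityTheory.beta (a + 1) (b + 1) :=
    ProbabilityTheory.beta_pos (by linarith) (by linarith)
  have himg : (fun u => s * u) '' Set.Ioo 0 1 = Set.Ioo 0 s := by
    rw [Set.image_mul_left_Ioo hs]
    simp
  have h1 := ProbabilityTheory.lintegral_betaPDF_eq_one (α := a + 1) (β := b + 1)
    (by linarith) (by linarith)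
  rw [ProbabilityTheory.lintegral_betaPDF] at h1
  rw [← himg, lintegral_image_eq_lintegral_abs_deriv_mul (measurableSet_Ioo (a := (0 : ℝ)) (b := 1))
    (f := fun u => s * u) (f' := fun _ => s)
    (fun x _ => ((hasDerivAt_id x).const_mul s).hasDerivWithinAt.congr_deriv (mul_one s))
    (mul_right_injective₀ hs.ne').injOn]
  refine Eq.trans ?_ (mul_one _)
  rw [← h1, ← lintegral_const_mul' _ _ ENNReal.ofReal_ne_top]
  refine setLIntegral_congr_fun measurableSet_Ioo fun u hu => ?_
  have hu0 : 0 < u := hu.1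
  have hu1 : 0 < 1 - u := sub_pos.2 hu.2
  rw [← ENNReal.ofReal_mul (abs_nonneg _), ← ENNReal.ofReal_mul (by positivity), abs_of_pos hs,
    show s - s * u = s * (1 - u) by ring, Real.mul_rpow hs.le hu0.le,
    Real.mul_rpow hs.le hu1.le, Real.rpow_add hs, Real.rpow_add hs, Real.rpow_one]
  congr 1
  field_simp
  ring_nf

/-- The open simplex. -/
def openSplx (d : ℕ) : Set (Fin d → ℝ) := {x | (∀ i, 0 < x i) ∧ ∑ i, x i < 1}

lemma isOpen_openSplx (d : ℕ) : IsOpen (openSplx d) := by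
  simp only [openSplx, Set.ofPred_and, Set.ofPred_forall]
  exact (isOpen_iInter_of_finite fun i => isOpen_lt continuous_const (continuous_apply i)).inter
    (isOpen_lt (by fun_prop) continuous_const)

/-- The Dirichlet integral over the simplex. -/
theorem lintegral_dirichlet (d : ℕ) (κ : Fin d → ℝ) (b : ℝ) (hκ : ∀ i, -1 < κ i) (hb : -1 < b) :
    ∫⁻ x in openSplx d, ENNReal.ofReal ((∏ i, x i ^ κ i) * (1 - ∑ i, x i) ^ b) =
      ENNReal.ofReal ((∏ i, Real.Gamma (κ i + 1)) * Real.Gamma (b + 1)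
        / Real.Gamma (∑ i, κ i + d + b + 1)) := by
  induction d generalizing b with
  | zero =>
    have h : openSplx 0 = Set.univ := by
      ext x
      simp [openSplx]
    have hG : Real.Gamma (b + 1) ≠ 0 := (Real.Gamma_pos_of_pos (by linarith)).ne'
    simp [h, hG, Measure.volume_pi_eq_dirac default]
  | succ d ih =>
    have hmp := (volume_preserving_piFinSuccAbove (fun _ : Fin (d + 1) => ℝ) 0).symm
    rw [← lintegral_indicator (isOpen_openSplx _).measurableSet,
      ← hmp.lintegral_comp_emb (MeasurableEquiv.measurableEmbedding _)]
    have hmeas : Measurable ((openSplx (d + 1)).indicator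
        fun x : Fin (d + 1) → ℝ => ENNReal.ofReal ((∏ i, x i ^ κ i) * (1 - ∑ i, x i) ^ b)) := by
      refine Measurable.indicator ?_ (isOpen_openSplx _).measurableSet
      fun_prop
    rw [Measure.volume_eq_prod]
    refine (lintegral_prod_symm' _ (hmeas.comp (MeasurableEquiv.measurable _))).trans ?_
    have hB : 0 ≤ ProbabilityTheory.beta (κ 0 + 1) (b + 1) :=
      (ProbabilityTheory.beta_pos (by linarith [hκ 0]) (by linarith)).le
    have hcons : ∀ (t : ℝ) (y : Fin d → ℝ),
        (MeasurableEquiv.piFinSuccAbove (fun _ : Fin (d + 1) => ℝ) 0).symm (t, y)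
          = Fin.cons (α := fun _ => ℝ) t y := fun t y => by
      rw [MeasurableEquiv.piFinSuccAbove_symm_apply, Fin.insertNthEquiv_zero]
      rfl
    have hinner : ∀ y : Fin d → ℝ, (∫⁻ t : ℝ, (openSplx (d + 1)).indicator
          (fun x : Fin (d + 1) → ℝ => ENNReal.ofReal ((∏ i, x i ^ κ i) * (1 - ∑ i, x i) ^ b))
          ((MeasurableEquiv.piFinSuccAbove (fun _ : Fin (d + 1) => ℝ) 0).symm (t, y)))
        = (openSplx d).indicator (fun y => ENNReal.ofReal
            (ProbabilityTheory.beta (κ 0 + 1) (b + 1)) * ENNReal.ofReal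
            ((∏ i, y i ^ κ i.succ) * (1 - ∑ i, y i) ^ (κ 0 + b + 1))) y := by
      intro y
      by_cases hy : y ∈ openSplx d
      · have hs : 0 < 1 - ∑ i, y i := sub_pos.2 hy.2
        have hP : 0 ≤ ∏ i, y i ^ κ i.succ :=
          Finset.prod_nonneg fun i _ => Real.rpow_nonneg (hy.1 i).le _
        rw [Set.indicator_of_mem hy, ← ENNReal.ofReal_mul hB,
          show ∀ p q r : ℝ, p * (q * r) = q * (p * r) by intros; ring, ENNReal.ofReal_mul hP,
          ← lintegral_beta_scaled (hκ 0) hb hs, ← lintegral_const_mul' _ _ ENNReal.ofReal_ne_top,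
          ← lintegral_indicator measurableSet_Ioo]
        refine lintegral_congr fun t => ?_
        have hiff : Fin.cons (α := fun _ => ℝ) t y ∈ openSplx (d + 1)
            ↔ t ∈ Set.Ioo 0 (1 - ∑ i, y i) := by
          simp only [openSplx, Set.mem_ofPred_eq, Fin.forall_fin_succ, Fin.cons_zero, Fin.cons_succ,
            Fin.sum_univ_succ, Set.mem_Ioo]
          constructor
          · rintro ⟨⟨h1, -⟩, h2⟩
            exact ⟨h1, by linarith⟩
          · rintro ⟨h1, h2⟩
            exact ⟨⟨h1, hy.1⟩, by linarith⟩
        rw [hcons]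
        by_cases ht : t ∈ Set.Ioo 0 (1 - ∑ i, y i)
        · rw [Set.indicator_of_mem (hiff.2 ht), Set.indicator_of_mem ht, ← ENNReal.ofReal_mul hP]
          simp only [Fin.prod_univ_succ, Fin.sum_univ_succ, Fin.cons_zero, Fin.cons_succ]
          rw [sub_add_eq_sub_sub_swap]
          ring_nf
        · rw [Set.indicator_of_notMem (mt hiff.1 ht), Set.indicator_of_notMem ht]
      · rw [Set.indicator_of_notMem hy, ← lintegral_zero]
        refine lintegral_congr fun t => Set.indicator_of_notMem (fun h => hy ?_) _
        rw [hcons] at h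
        simp only [openSplx, Set.mem_ofPred_eq, Fin.forall_fin_succ,
          Fin.cons_zero, Fin.cons_succ, Fin.sum_univ_succ] at h
        exact ⟨h.1.2, by linarith [h.1.1, h.2]⟩
    simp only [Function.comp_def]
    rw [lintegral_congr hinner, lintegral_indicator (isOpen_openSplx _).measurableSet,
      lintegral_const_mul' _ _ ENNReal.ofReal_ne_top,
      ih (fun i => κ i.succ) (κ 0 + b + 1) (fun i => hκ _) (by linarith [hκ 0]),
      ← ENNReal.ofReal_mul hB]
    have hG : Real.Gamma (κ 0 + 1 + (b + 1)) ≠ 0 :=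
      (Real.Gamma_pos_of_pos (by linarith [hκ 0])).ne'
    rw [ProbabilityTheory.beta, Fin.prod_univ_succ, Fin.sum_univ_succ,
      show κ 0 + b + 1 + 1 = κ 0 + 1 + (b + 1) by ring]
    push_cast
    rw [show ∑ i : Fin d, κ i.succ + d + (κ 0 + b + 1) + 1
      = κ 0 + ∑ i : Fin d, κ i.succ + (d + 1) + b + 1 by ring]
    field_simp

end Dirichlet

section PartialDerivative

lemma hasFDerivAt_eval {σ : Type*} [Fintype σ] [DecidableEq σ] (f : MvPolynomial σ ℝ) (x : σ → ℝ) :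
    HasFDerivAt (fun x => MvPolynomial.eval x f)
      (∑ i, MvPolynomial.eval x (MvPolynomial.pderiv i f) •
        (ContinuousLinearMap.proj i : (σ → ℝ) →L[ℝ] ℝ)) x := by
  induction f using MvPolynomial.induction_on with
  | C r => simpa using hasFDerivAt_const r x
  | add p q hp hq =>
    simp only [map_add]
    exact (hp.fun_add hq).congr_fderiv (by simp [add_smul, Finset.sum_add_distrib])
  | mul_X p i hp =>
    have h := hp.mul (hasFDerivAt_apply (𝕜 := ℝ) i x)
    simp only [map_mul, MvPolynomial.eval_X]
    refine h.congr_fderiv ?_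
    ext v
    simp [Pi.single_apply, Finset.sum_add_distrib, add_mul, Finset.mul_sum, mul_assoc,
      apply_ite (MvPolynomial.eval x)]

lemma pd_eval {d : ℕ} (i : Fin d) (f : MvPolynomial (Fin d) ℝ) (x : Fin d → ℝ) :
    pd i (fun x => MvPolynomial.eval x f) x
      = MvPolynomial.eval x (MvPolynomial.pderiv i f) := by
  rw [pd, (hasFDerivAt_eval f x).fderiv]
  simp [Pi.single_apply]

end PartialDerivative

section Moments

variable {d : ℕ}

lemma dirichlet_weight_pos {κ : Fin d → ℝ} {b : ℝ} {x : Fin d → ℝ} (hx : x ∈ openSplx d) :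
    0 < (∏ i, x i ^ κ i) * (1 - ∑ i, x i) ^ b :=
  mul_pos (Finset.prod_pos fun i _ => Real.rpow_pos_of_pos (hx.1 i) _)
    (Real.rpow_pos_of_pos (sub_pos.2 hx.2) _)

lemma ae_restrict_dirichlet_weight_nonneg (κ : Fin d → ℝ) (b : ℝ) :
    0 ≤ᵐ[volume.restrict (openSplx d)] fun x => (∏ i, x i ^ κ i) * (1 - ∑ i, x i) ^ b :=
  (ae_restrict_mem (isOpen_openSplx d).measurableSet).mono fun _ hx => (dirichlet_weight_pos hx).le

lemma integrableOn_dirichlet {κ : Fin d → ℝ} {b : ℝ} (hκ : ∀ i, -1 < κ i) (hb : -1 < b) :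
    IntegrableOn (fun x => (∏ i, x i ^ κ i) * (1 - ∑ i, x i) ^ b) (openSplx d) := by
  refine ⟨by fun_prop, ?_⟩
  rw [hasFiniteIntegral_iff_ofReal (ae_restrict_dirichlet_weight_nonneg κ b),
    lintegral_dirichlet d κ b hκ hb]
  exact ENNReal.ofReal_lt_top

lemma integral_dirichlet {κ : Fin d → ℝ} {b : ℝ} (hκ : ∀ i, -1 < κ i) (hb : -1 < b) :
    ∫ x in openSplx d, (∏ i, x i ^ κ i) * (1 - ∑ i, x i) ^ b =
      (∏ i, Real.Gamma (κ i + 1)) * Real.Gamma (b + 1) / Real.Gamma (∑ i, κ i + d + b + 1) := by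
  have hs : 0 ≤ ∑ i, (κ i + 1) := Finset.sum_nonneg fun i _ => by linarith [hκ i]
  simp only [Finset.sum_add_distrib, Finset.sum_const, Finset.card_univ, Fintype.card_fin,
    nsmul_eq_mul, mul_one] at hs
  rw [integral_eq_lintegral_of_nonneg_ae (ae_restrict_dirichlet_weight_nonneg κ b) (by fun_prop),
    lintegral_dirichlet d κ b hκ hb, ENNReal.toReal_ofReal]
  have h1 : 0 ≤ ∏ i, Real.Gamma (κ i + 1) :=
    Finset.prod_nonneg fun i _ => (Real.Gamma_pos_of_pos (by linarith [hκ i])).le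
  exact div_nonneg (mul_nonneg h1 (Real.Gamma_pos_of_pos (by linarith)).le)
    (Real.Gamma_pos_of_pos (by linarith)).le

variable {κ : Fin (d + 1) → ℝ}

lemma Wk_pos {x : Fin d → ℝ} (hx : x ∈ openSplx d) : 0 < Wk κ x := dirichlet_weight_pos hx

lemma eval_monomial_mul_Wk {x : Fin d → ℝ} (hx : x ∈ openSplx d) (s : Fin d →₀ ℕ) (r : ℝ) :
    eval x (monomial s r) * Wk κ x =
      r * ((∏ i, x i ^ (κ i.castSucc + s i)) * (1 - ∑ i, x i) ^ κ (Fin.last d)) := by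
  have hp : (s.prod fun i k => x i ^ k) = ∏ i, x i ^ s i :=
    Finsupp.prod_fintype s (fun i k => x i ^ k) fun i => pow_zero (x i)
  have h : ∏ i, x i ^ (κ i.castSucc + s i) = (∏ i, x i ^ s i) * ∏ i, x i ^ κ i.castSucc := by
    rw [← Finset.prod_mul_distrib]
    refine Finset.prod_congr rfl fun i _ => ?_
    rw [Real.rpow_add (hx.1 i), Real.rpow_natCast, mul_comm]
  rw [eval_monomial, hp, Wk, h]
  ring

lemma neg_one_lt_add_nat {t : ℝ} (ht : -1 < t) (m : ℕ) : -1 < t + m := by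
  have := (Nat.cast_nonneg m : (0 : ℝ) ≤ m)
  linarith

lemma integrableOn_eval_mul_Wk (hκ : ∀ i, -1 < κ i) (p : MvPolynomial (Fin d) ℝ) :
    IntegrableOn (fun x => eval x p * Wk κ x) (openSplx d) := by
  induction p using MvPolynomial.induction_on' with
  | add p q hp hq =>
    simp only [map_add, add_mul]
    exact hp.add hq
  | monomial s r =>
    refine IntegrableOn.congr_fun ?_ (fun x hx => (eval_monomial_mul_Wk hx s r).symm)
      (isOpen_openSplx d).measurableSet
    exact (integrableOn_dirichlet (fun i => neg_one_lt_add_nat (hκ _) (s i)) (hκ _)).const_mul r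

/-- Integration of polynomials against the Jacobi weight on the simplex. -/
def moment (hκ : ∀ i, -1 < κ i) : MvPolynomial (Fin d) ℝ →ₗ[ℝ] ℝ where
  toFun p := ∫ x in openSplx d, eval x p * Wk κ x
  map_add' p q := by
    simp only [map_add, add_mul]
    exact integral_add (integrableOn_eval_mul_Wk hκ p) (integrableOn_eval_mul_Wk hκ q)
  map_smul' r p := by
    simp only [smul_eval, mul_assoc, RingHom.id_apply, smul_eq_mul]
    exact integral_const_mul _ _

lemma moment_apply (hκ : ∀ i, -1 < κ i) (p : MvPolynomial (Fin d) ℝ) :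
    moment hκ p = ∫ x in openSplx d, eval x p * Wk κ x := rfl

lemma moment_nonneg (hκ : ∀ i, -1 < κ i) {p : MvPolynomial (Fin d) ℝ}
    (hp : ∀ x ∈ openSplx d, 0 ≤ eval x p) : 0 ≤ moment hκ p :=
  setIntegral_nonneg (isOpen_openSplx d).measurableSet
    fun x hx => mul_nonneg (hp x hx) (Wk_pos hx).le

lemma moment_monomial (hκ : ∀ i, -1 < κ i) (s : Fin d →₀ ℕ) (r : ℝ) :
    moment hκ (monomial s r) = r * ((∏ i, Real.Gamma (κ i.castSucc + s i + 1))
      * Real.Gamma (κ (Fin.last d) + 1) / Real.Gamma (∑ k, κ k + d + 1 + s.degree)) := by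
  rw [moment_apply, setIntegral_congr_fun (isOpen_openSplx d).measurableSet
    (fun x hx => eval_monomial_mul_Wk hx s r), integral_const_mul,
    integral_dirichlet (fun i => neg_one_lt_add_nat (hκ _) (s i)) (hκ _), Fin.sum_univ_castSucc,
    Finset.sum_add_distrib, Finsupp.degree_eq_sum]
  push_cast
  ring_nf

lemma sum_add_card_add_one_pos (hκ : ∀ i, -1 < κ i) : 0 < ∑ k, κ k + d + 1 := by
  have h : 0 < ∑ k, (κ k + 1) :=
    Finset.sum_pos (fun k _ => by linarith [hκ k]) Finset.univ_nonempty
  simp only [Finset.sum_add_distrib, Finset.sum_const, Finset.card_univ, Fintype.card_fin,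
    nsmul_eq_mul, mul_one] at h
  push_cast at h
  linarith

/-- The moment relations of the Jacobi weight. -/
lemma moment_relation (hκ : ∀ i, -1 < κ i) (i : Fin d) (p : MvPolynomial (Fin d) ℝ) :
    moment hκ (X i * (euler p + (∑ k, κ k + d + 1) • p))
      = moment hκ (X i * pderiv i p + (κ i.castSucc + 1) • p) := by
  induction p using MvPolynomial.induction_on' with
  | add p q hp hq =>
    simp only [map_add, mul_add, smul_add] at hp hq ⊢
    linarith
  | monomial s r =>
    have hc : 0 < ∑ k, κ k + d + 1 + s.degree := by
      have := sum_add_card_add_one_pos hκ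
      positivity
    have hi : 0 < κ i.castSucc + s i + 1 := by linarith [neg_one_lt_add_nat (hκ i.castSucc) (s i)]
    have hG := (Real.Gamma_pos_of_pos hc).ne'
    have h1 : ∏ j : Fin d,
        Real.Gamma (κ j.castSucc + ((s + Finsupp.single i 1 : Fin d →₀ ℕ) j : ℕ) + 1)
        = (κ i.castSucc + s i + 1) * ∏ j, Real.Gamma (κ j.castSucc + s j + 1) := by
      rw [← Finset.mul_prod_erase _ _ (Finset.mem_univ i), ← Finset.mul_prod_erase Finset.univ
        (fun j => Real.Gamma (κ j.castSucc + s j + 1)) (Finset.mem_univ i), ← mul_assoc,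
        ← Real.Gamma_add_one hi.ne']
      congr 1
      · simp
        ring_nf
      · refine Finset.prod_congr rfl fun j hj => ?_
        simp [Finsupp.single_eq_of_ne (Finset.ne_of_mem_erase hj)]
    have h2 : Real.Gamma (∑ k, κ k + d + 1 + (s + Finsupp.single i 1).degree)
        = (∑ k, κ k + d + 1 + s.degree) * Real.Gamma (∑ k, κ k + d + 1 + s.degree) := by
      rw [← Real.Gamma_add_one hc.ne']
      simp [add_assoc]
    rw [X_mul_pderiv_monomial, euler_of_isHomogeneous (isHomogeneous_monomial r rfl), ← add_smul,
      mul_smul_comm, ← Nat.cast_smul_eq_nsmul ℝ, ← add_smul, map_smul, map_smul, mul_comm (X i), X,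
      monomial_mul, moment_monomial, moment_monomial, h1, h2, smul_eq_mul, smul_eq_mul]
    have hc' := hc.ne'
    field_simp
    ring

lemma moment_mul_self_pos [NeZero d] (hκ : ∀ i, -1 < κ i) (p : MvPolynomial (Fin d) ℝ)
    (hp : p ≠ 0) : 0 < moment hκ (p * p) := by
  have hnn : ∀ x ∈ openSplx d, 0 ≤ eval x (p * p) := fun x _ => by
    rw [map_mul]
    exact mul_self_nonneg _
  refine lt_of_le_of_ne (moment_nonneg hκ hnn) fun h0 => hp ?_
  have hae : 0 ≤ᵐ[volume.restrict (openSplx d)] fun x => eval x (p * p) * Wk κ x :=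
    (ae_restrict_mem (isOpen_openSplx d).measurableSet).mono
      fun x hx => mul_nonneg (hnn x hx) (Wk_pos hx).le
  have hz := (setIntegral_eq_zero_iff_of_nonneg_ae hae (integrableOn_eval_mul_Wk hκ _)).1 h0.symm
  have hz' : (fun x => eval x p) =ᵐ[volume.restrict (openSplx d)] fun _ => 0 := by
    filter_upwards [hz, ae_restrict_mem (isOpen_openSplx d).measurableSet] with x hx hxm
    simpa [(Wk_pos hxm).ne'] using hx
  have heq := Measure.eqOn_open_of_ae_eq hz' (isOpen_openSplx d)
    (MvPolynomial.continuous_eval p).continuousOn continuousOn_const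
  have hd : (0 : ℝ) < d := Nat.cast_pos.2 (NeZero.pos d)
  refine funext_set (fun _ => Set.Ioo 0 (1 / (d : ℝ)))
    (fun _ => Set.Ioo_infinite (by positivity)) fun x hx => ?_
  rw [map_zero]
  refine heq ⟨fun i => (hx i (Set.mem_univ i)).1, ?_⟩
  calc ∑ i, x i < ∑ _i : Fin d, 1 / (d : ℝ) :=
        Finset.sum_lt_sum_of_nonempty Finset.univ_nonempty fun i _ => (hx i (Set.mem_univ i)).2
    _ = 1 := by simp [hd.ne']

end Moments

section Norms

variable {d : ℕ} {κ : Fin (d + 1) → ℝ}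

lemma volume_sum_eq_one [NeZero d] : volume {x : Fin d → ℝ | ∑ i, x i = 1} = 0 := by
  let φ : (Fin d → ℝ) →ₗ[ℝ] ℝ := ∑ i, LinearMap.proj i
  have hφ : ∀ x, φ x = ∑ i, x i := fun x => by simp [φ]
  let p : Fin d → ℝ := Pi.single 0 1
  have hp : φ p = 1 := by simp [hφ, p]
  have hS : ({x : Fin d → ℝ | ∑ i, x i = 1} : Set _) = AffineSubspace.mk' p (LinearMap.ker φ) := by
    ext x
    rw [SetLike.mem_coe, AffineSubspace.mem_mk', LinearMap.mem_ker, vsub_eq_sub, map_sub, hp, hφ,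
      sub_eq_zero, Set.mem_ofPred_eq]
  rw [hS]
  refine Measure.addHaar_affineSubspace _ _ fun h => ?_
  have h0 : (0 : Fin d → ℝ) ∈ AffineSubspace.mk' p (LinearMap.ker φ) :=
    h ▸ AffineSubspace.mem_top ..
  simp [AffineSubspace.mem_mk', hp] at h0

lemma splx_ae_eq_openSplx [NeZero d] : Splx d =ᵐ[volume] openSplx d := by
  have h1 : ∀ᵐ x : Fin d → ℝ, ∑ i, x i ≠ 1 := compl_mem_ae_iff.2 volume_sum_eq_one
  have h2 : ∀ᵐ x : Fin d → ℝ, ∀ i, x i ≠ 0 :=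
    ae_all_iff.2 fun i => Measure.ae_eval_ne (fun _ => (volume : Measure ℝ)) i 0
  filter_upwards [h1, h2] with x hx1 hx2
  refine propext ⟨fun h => ?_, fun h => ⟨fun i => (h.1 i).le, h.2.le⟩⟩
  exact ⟨fun i => lt_of_le_of_ne (h.1 i) (hx2 i).symm, lt_of_le_of_ne h.2 hx1⟩

lemma bk_nonneg (hκ : ∀ i, -1 < κ i) : 0 ≤ bk κ :=
  div_nonneg (Real.Gamma_pos_of_pos (sum_add_card_add_one_pos hκ)).le
    (Finset.prod_nonneg fun i _ => (Real.Gamma_pos_of_pos (by linarith [hκ i])).le)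

lemma nrm2_sq_eq_of_eqOn [NeZero d] (hκ : ∀ i, -1 < κ i) {F : (Fin d → ℝ) → ℝ}
    {p : MvPolynomial (Fin d) ℝ} (h : ∀ x ∈ openSplx d, F x * F x = eval x p) :
    nrm2 κ F ^ 2 = bk κ * moment hκ p := by
  have hi : ipk κ F F = bk κ * moment hκ p := by
    rw [ipk, setIntegral_congr_set splx_ae_eq_openSplx, moment_apply]
    congr 1
    exact setIntegral_congr_fun (isOpen_openSplx d).measurableSet fun x hx => by rw [← h x hx]
  rw [nrm2, hi, Real.sq_sqrt]
  exact mul_nonneg (bk_nonneg hκ) (moment_nonneg hκ fun x hx => h x hx ▸ mul_self_nonneg _)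

lemma nrm2_eval_sq [NeZero d] (hκ : ∀ i, -1 < κ i) (f : MvPolynomial (Fin d) ℝ) :
    nrm2 κ (fun x => eval x f) ^ 2 = bk κ * moment hκ (f * f) :=
  nrm2_sq_eq_of_eqOn hκ fun x _ => (map_mul (eval x) f f).symm

lemma aform_eval [NeZero d] (hκ : ∀ i, -1 < κ i) (f : MvPolynomial (Fin d) ℝ) :
    aform κ (fun x => eval x f)
      = bk κ * moment hκ (∑ i, X i * (1 - sumX) * (pderiv i f * pderiv i f)) := by
  rw [aform, map_sum, Finset.mul_sum]
  refine Finset.sum_congr rfl fun i _ => nrm2_sq_eq_of_eqOn hκ fun x hx => ?_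
  have h := Real.mul_self_sqrt (mul_nonneg (hx.1 i).le (sub_pos.2 hx.2).le)
  rw [pd_eval, mul_mul_mul_comm, h]
  simp [sumX]

lemma moment_gradient_le_carre (hκ : ∀ i, -1 < κ i) (f : MvPolynomial (Fin d) ℝ) :
    moment hκ (∑ i, X i * (1 - sumX) * (pderiv i f * pderiv i f)) ≤ moment hκ (carre f f) := by
  rw [← sub_nonneg, ← map_sub]
  refine moment_nonneg hκ fun x hx => ?_
  have h := Finset.sum_sq_le_sum_mul_sum_of_sq_le_mul Finset.univ
    (r := fun i => x i * eval x (pderiv i f)) (f := x) (g := fun i => x i * eval x (pderiv i f) ^ 2)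
    (fun i _ => (hx.1 i).le) (fun i _ => mul_nonneg (hx.1 i).le (sq_nonneg _))
    (fun i _ => le_of_eq (by ring))
  have h1 : ∑ i, x i * (1 - ∑ j, x j) * (eval x (pderiv i f) * eval x (pderiv i f))
      = (1 - ∑ j, x j) * ∑ i, x i * eval x (pderiv i f) ^ 2 := by
    rw [Finset.mul_sum]
    exact Finset.sum_congr rfl fun i _ => by ring
  have h2 : ∑ i, x i * eval x (pderiv i f) * eval x (pderiv i f)
      = ∑ i, x i * eval x (pderiv i f) ^ 2 := Finset.sum_congr rfl fun i _ => by ring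
  simp only [carre, sumX, euler_apply, map_sub, map_sum, map_mul, eval_X, map_one, h1, h2]
  linarith

lemma gradient_eq_carre {f : MvPolynomial (Fin d) ℝ} (hf : ∀ i j, pderiv i f = pderiv j f) :
    ∑ i, X i * (1 - sumX) * (pderiv i f * pderiv i f) = carre f f := by
  rcases isEmpty_or_nonempty (Fin d) with h | ⟨⟨j⟩⟩
  · simp [carre, euler_apply]
  · simp only [carre, euler_apply, fun i => hf i j, ← Finset.sum_mul]
    simp only [sumX]
    ring

end Norms

end SimplexJacobi

/-- the inequality \eqref{eq:B-ineq0a}, and its sharpness. -/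
theorem stmt5 (d : ℕ) (hd : 2 ≤ d) (κ : Fin (d+1) → ℝ) (hκ : ∀ i, -1 < κ i) (n : ℕ) :
    (∀ f : MvPolynomial (Fin d) ℝ, f.totalDegree ≤ n →
      aform κ (fun x => MvPolynomial.eval x f) ≤
        (n : ℝ) * ((n : ℝ) + (∑ k, κ k) + (d : ℝ)) *
          nrm2 κ (fun x => MvPolynomial.eval x f) ^ 2) ∧
    (∃ f : MvPolynomial (Fin d) ℝ, f ≠ 0 ∧ f.totalDegree = n ∧
      aform κ (fun x => MvPolynomial.eval x f) =
        (n : ℝ) * ((n : ℝ) + (∑ k, κ k) + (d : ℝ)) *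
          nrm2 κ (fun x => MvPolynomial.eval x f) ^ 2) := by
  have : NeZero d := ⟨by omega⟩
  have hc : -1 < ∑ k, κ k + (d : ℝ) := by
    linarith [SimplexJacobi.sum_add_card_add_one_pos hκ]
  have hL : ∀ i p, SimplexJacobi.moment hκ
      (MvPolynomial.X i * (SimplexJacobi.euler p + ((∑ k, κ k + (d : ℝ)) + 1) • p))
      = SimplexJacobi.moment hκ (MvPolynomial.X i * MvPolynomial.pderiv i p
        + (κ i.castSucc + 1) • p) :=
    fun i p => SimplexJacobi.moment_relation hκ i p
  have hpos := SimplexJacobi.moment_mul_self_pos hκ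
  have heig : (n : ℝ) * ((n : ℝ) + (∑ k, κ k) + (d : ℝ))
      = SimplexJacobi.eig (∑ k, κ k + (d : ℝ)) n := by
    rw [SimplexJacobi.eig, add_assoc]
  refine ⟨fun f hf => ?_, ?_⟩
  · rw [SimplexJacobi.aform_eval hκ, SimplexJacobi.nrm2_eval_sq hκ, heig, mul_left_comm]
    have hle := @SimplexJacobi.carre_le (Fin d) _ (∑ k, κ k + (d : ℝ))
      (fun i => κ i.castSucc + 1) (SimplexJacobi.moment hκ) hc hL hpos n f hf
    exact mul_le_mul_of_nonneg_left ((SimplexJacobi.moment_gradient_le_carre hκ f).trans hle)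
      (SimplexJacobi.bk_nonneg hκ)
  · obtain ⟨f, hf0, hfd, hsymm, hf⟩ := @SimplexJacobi.exists_carre_eq (Fin d) _
      (∑ k, κ k + (d : ℝ)) (fun i => κ i.castSucc + 1) (SimplexJacobi.moment hκ) _ hL hpos n
    refine ⟨f, hf0, hfd, ?_⟩
    rw [SimplexJacobi.aform_eval hκ, SimplexJacobi.nrm2_eval_sq hκ, heig,
      SimplexJacobi.gradient_eq_carre hsymm, hf, mul_left_comm]
end
end
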